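/- Every triangulation of a 3-dimensional m-antiprism (in any coordinatization) has exactly 2m-4 cap-supported tetrahedra and at least m-1 mixed tetrahedra, hence at least 3m-5 tetrahedra in total; moreover a triangulation with exactly 3m-5 tetrahedra exists, obtained by coning a top vertex v to a triangulation of the bottom m-gon and to all triangular facets not containing v. -/

import Mathlib

open Set MeasureTheory
open scoped Classical

noncomputable section

abbrev Pt3 := Fin 3 → ℝ

/-- A (geometric) tetrahedron: 4 affinely independent points. -/
def IsTet (σ : Finset Pt3) : Prop :=
  σ.card = 4 ∧ AffineIndependent ℝ (fun p : (σ : Set Pt3) => (p : Pt3))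

/-- A dissection of the convex polytope `conv V` using only vertices in `V`:
tetrahedra with pairwise disjoint interiors covering the polytope. -/
def IsDissection (V : Finset Pt3) (D : Finset (Finset Pt3)) : Prop :=
  (∀ σ ∈ D, IsTet σ ∧ (σ : Set Pt3) ⊆ (V : Set Pt3)) ∧
  (∀ σ ∈ D, ∀ τ ∈ D, σ ≠ τ →
    interior (convexHull ℝ (σ : Set Pt3)) ∩ interior (convexHull ℝ (τ : Set Pt3)) = ∅) ∧
  (⋃ σ ∈ D, convexHull ℝ (σ : Set Pt3)) = convexHull ℝ (V : Set Pt3)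

/-- A triangulation: a dissection in which any two tetrahedra meet in a common
(possibly empty) face. -/
def IsTriangulation (V : Finset Pt3) (D : Finset (Finset Pt3)) : Prop :=
  IsDissection V D ∧
  ∀ σ ∈ D, ∀ τ ∈ D,
    convexHull ℝ (σ : Set Pt3) ∩ convexHull ℝ (τ : Set Pt3)
      = convexHull ℝ ((σ ∩ τ : Finset Pt3) : Set Pt3)

/-- `ψ` realizes a combinatorial equivalence between the polytopes with vertex
sets `A` and `V`: it maps the vertices of `conv A` bijectively onto those of
`conv V`, inducing an isomorphism of face lattices (faces being encoded as
extreme subsets spanned by vertex sets). -/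
def CombEquiv (A V : Finset Pt3) (ψ : Pt3 → Pt3) : Prop :=
  Set.BijOn ψ (A : Set Pt3) (V : Set Pt3) ∧
    ∀ S ⊆ (A : Set Pt3),
      (IsExtreme ℝ (convexHull ℝ (A : Set Pt3)) (convexHull ℝ S) ↔
       IsExtreme ℝ (convexHull ℝ (V : Set Pt3)) (convexHull ℝ (ψ '' S)))

/-- The bottom cap of the standard `m`-prism / `m`-antiprism: the vertices of a
regular `m`-gon at height `0`. -/
def stdBot (m : ℕ) : Finset Pt3 :=
  (Finset.univ : Finset (Fin m)).image
    (fun k => ![Real.cos (2 * Real.pi * k.1 / m), Real.sin (2 * Real.pi * k.1 / m), 0])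

/-- The top cap of the standard `m`-prism: the same regular `m`-gon at height `1`. -/
def stdPrismTop (m : ℕ) : Finset Pt3 :=
  (Finset.univ : Finset (Fin m)).image
    (fun k => ![Real.cos (2 * Real.pi * k.1 / m), Real.sin (2 * Real.pi * k.1 / m), 1])

/-- The top cap of the standard `m`-antiprism: the regular `m`-gon at height `1`,
rotated by half a step. -/
def stdAntiTop (m : ℕ) : Finset Pt3 :=
  (Finset.univ : Finset (Fin m)).image
    (fun k => ![Real.cos (Real.pi * (2 * k.1 + 1) / m), Real.sin (Real.pi * (2 * k.1 + 1) / m), 1])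


abbrev Aff3 := Pt3 →ᵃ[ℝ] ℝ

abbrev hull (s : Finset Pt3) : Set Pt3 := convexHull ℝ (s : Set Pt3)

lemma aff_sum (f : Aff3) (s : Finset Pt3) (w : Pt3 → ℝ) (hw : ∑ y ∈ s, w y = 1) :
    f (∑ y ∈ s, w y • y) = ∑ y ∈ s, w y * f y := by
  have key : ∀ x, f x = f.linear x + f 0 := fun x => by
    rw [AffineMap.decomp' f]; simp
  rw [key, map_sum]
  simp only [map_smul, smul_eq_mul]
  have : ∑ y ∈ s, w y * f y = ∑ y ∈ s, (w y * f.linear y + w y * f 0) := by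
    refine Finset.sum_congr rfl fun y _ => ?_
    rw [key y]; ring
  rw [this, Finset.sum_add_distrib, ← Finset.sum_mul, hw, one_mul]

lemma aff_line (f : Aff3) (x y : Pt3) (e : ℝ) :
    f (AffineMap.lineMap x y e) = (1 - e) * f x + e * f y := by
  rw [AffineMap.apply_lineMap, AffineMap.lineMap_apply_ring]

lemma aff_cont (f : Aff3) : Continuous f := AffineMap.continuous_of_finiteDimensional f

lemma hull_nonneg {s : Finset Pt3} {f : Aff3} (hf : ∀ v ∈ s, 0 ≤ f v) {x : Pt3}
    (hx : x ∈ hull s) : 0 ≤ f x := by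
  obtain ⟨w, h0, h1, rfl⟩ := Finset.mem_convexHull'.1 hx
  rw [aff_sum f s w h1]
  exact Finset.sum_nonneg fun y hy => mul_nonneg (h0 y hy) (hf y hy)

lemma hull_zero {s : Finset Pt3} {f : Aff3} (hf : ∀ v ∈ s, f v = 0) {x : Pt3}
    (hx : x ∈ hull s) : f x = 0 := by
  obtain ⟨w, h0, h1, rfl⟩ := Finset.mem_convexHull'.1 hx
  rw [aff_sum f s w h1]
  exact Finset.sum_eq_zero fun y hy => by rw [hf y hy, mul_zero]

lemma face_mem {s : Finset Pt3} {f : Aff3} (hf : ∀ v ∈ s, 0 ≤ f v) {x : Pt3}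
    (hx : x ∈ hull s) (h : f x = 0) : x ∈ hull (s.filter (fun v => f v = 0)) := by
  obtain ⟨w, h0, h1, rfl⟩ := Finset.mem_convexHull'.1 hx
  rw [aff_sum f s w h1] at h
  have hz := (Finset.sum_eq_zero_iff_of_nonneg
    (fun y hy => mul_nonneg (h0 y hy) (hf y hy))).1 h
  have hw : ∀ y ∈ s, y ∉ s.filter (fun v => f v = 0) → w y = 0 := by
    intro y hy hn
    rcases mul_eq_zero.1 (hz y hy) with h | h
    · exact h
    · exact absurd (Finset.mem_filter.2 ⟨hy, h⟩) hn
  refine Finset.mem_convexHull'.2 ⟨w, fun y hy => h0 y (Finset.filter_subset _ _ hy), ?_, ?_⟩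
  · rw [← h1]; exact Finset.sum_subset (Finset.filter_subset _ _) hw
  · exact Finset.sum_subset (Finset.filter_subset _ _)
      fun y hy hn => by rw [hw y hy hn, zero_smul]

lemma hull_mono {s t : Finset Pt3} (h : s ⊆ t) : hull s ⊆ hull t :=
  convexHull_mono (by exact_mod_cast h)

lemma mem_hull {s : Finset Pt3} {x : Pt3} (h : x ∈ s) : x ∈ hull s :=
  subset_convexHull ℝ _ (by exact_mod_cast h)

lemma hull_line {s : Finset Pt3} {x y : Pt3} (hx : x ∈ hull s) (hy : y ∈ hull s) {e : ℝ}
    (h0 : 0 ≤ e) (h1 : e ≤ 1) : AffineMap.lineMap x y e ∈ hull s :=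
  (convex_convexHull ℝ _).lineMap_mem hx hy ⟨h0, h1⟩

lemma hull_compact (s : Finset Pt3) : IsCompact (hull s) :=
  s.finite_toSet.isCompact_convexHull ℝ

/-- Affine independence through coordinate functionals. -/
def Coords (s : Finset Pt3) : Prop :=
  ∀ u ∈ s, ∃ f : Aff3, f u = 1 ∧ ∀ v ∈ s, v ≠ u → f v = 0

lemma coords_of_ai {s : Finset Pt3}
    (h : AffineIndependent ℝ (fun p : (s : Set Pt3) => (p : Pt3))) : Coords s := by
  intro u hu
  obtain ⟨t, hst, hai, hspan⟩ := exists_subset_affineIndependent_affineSpan_eq_top h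
  let b : AffineBasis t ℝ Pt3 := ⟨fun p => (p : Pt3), hai, by simpa using hspan⟩
  have hut : u ∈ t := hst (by exact_mod_cast hu)
  refine ⟨b.coord ⟨u, hut⟩, ?_, ?_⟩
  · have := b.coord_apply_eq ⟨u, hut⟩
    exact this
  · intro v hv hvu
    have hvt : v ∈ t := hst (by exact_mod_cast hv)
    have := b.coord_apply_ne (i := ⟨u, hut⟩) (j := ⟨v, hvt⟩)
      (by intro h; exact hvu (by simpa using h.symm))
    exact this

lemma ai_of_coords {s : Finset Pt3} (h : Coords s) :
    AffineIndependent ℝ (fun p : (s : Set Pt3) => (p : Pt3)) := by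
  rw [affineIndependent_iff]
  intro t w hw hs i hi
  obtain ⟨f, hf1, hf0⟩ := h i.1 (by exact_mod_cast i.2)
  have key : ∀ x, f x = f.linear x + f 0 := fun x => by
    rw [AffineMap.decomp' f]; simp
  have h1 : ∑ e ∈ t, w e * f e = 0 := by
    have : ∑ e ∈ t, w e * f e = f.linear (∑ e ∈ t, w e • (e : Pt3)) + (∑ e ∈ t, w e) * f 0 := by
      rw [map_sum, Finset.sum_mul, ← Finset.sum_add_distrib]
      refine Finset.sum_congr rfl fun e _ => ?_
      rw [key e, map_smul, smul_eq_mul]; ring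
    rw [this, hs, hw]; simp
  rw [Finset.sum_eq_single i] at h1
  · simpa [hf1] using h1
  · intro b _ hb
    rw [hf0 b.1 (by exact_mod_cast b.2) (fun h => hb (Subtype.ext h)), mul_zero]
  · intro h; exact absurd hi h

lemma tet_iff {s : Finset Pt3} : IsTet s ↔ s.card = 4 ∧ Coords s :=
  ⟨fun h => ⟨h.1, coords_of_ai h.2⟩, fun h => ⟨h.1, ai_of_coords h.2⟩⟩

/-- Full barycentric coordinates for a tetrahedron. -/
lemma tet_bary {s : Finset Pt3} (h : IsTet s) : ∃ c : Pt3 → Aff3,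
    (∀ u ∈ s, c u u = 1) ∧ (∀ u ∈ s, ∀ v ∈ s, v ≠ u → c u v = 0) ∧
    (∀ x, (∀ u ∈ s, 0 ≤ c u x) → x ∈ hull s) ∧
    (∀ (f : Aff3) x, f x = ∑ u ∈ s, c u x * f u) := by
  have hspan : affineSpan ℝ (Set.range (fun p : (s : Set Pt3) => (p : Pt3))) = ⊤ := by
    rw [h.2.affineSpan_eq_top_iff_card_eq_finrank_add_one]
    simp [h.1]
  let b : AffineBasis (s : Set Pt3) ℝ Pt3 := ⟨fun p => (p : Pt3), h.2, hspan⟩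
  have hb : ∀ i, b i = (i : Pt3) := fun i => rfl
  have hsum1 : ∀ x, ∑ i : (s : Set Pt3), b.coord i x = 1 := fun x => b.sum_coord_apply_eq_one x
  have hsumx : ∀ x, ∑ i : (s : Set Pt3), b.coord i x • (i : Pt3) = x := fun x =>
    b.linear_combination_coord_eq_self x
  let c : Pt3 → Aff3 := fun u => if hu : u ∈ (s : Set Pt3) then b.coord ⟨u, hu⟩ else 0
  have hc : ∀ i : (s : Set Pt3), c i.1 = b.coord i := fun i => by
    have := i.2
    simp only [c]; rw [dif_pos this]
  have hS1 : ∀ x, ∑ u ∈ s, c u x = 1 := fun x => by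
    rw [← hsum1 x, ← Finset.sum_coe_sort]
    exact Finset.sum_congr rfl fun i _ => by rw [hc ⟨i.1, i.2⟩]; rfl
  have hSx : ∀ x, ∑ u ∈ s, c u x • u = x := fun x => by
    conv_rhs => rw [← hsumx x]
    rw [← Finset.sum_coe_sort]
    exact Finset.sum_congr rfl fun i _ => by rw [hc ⟨i.1, i.2⟩]; rfl
  refine ⟨c, ?_, ?_, ?_, ?_⟩
  · intro u hu
    rw [hc ⟨u, by exact_mod_cast hu⟩]
    exact b.coord_apply_eq ⟨u, by exact_mod_cast hu⟩
  · intro u hu v hv hvu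
    rw [hc ⟨u, by exact_mod_cast hu⟩]
    exact b.coord_apply_ne (i := ⟨u, by exact_mod_cast hu⟩) (j := ⟨v, by exact_mod_cast hv⟩)
      (by intro h; exact hvu (by simpa using h.symm))
  · intro x hx
    exact Finset.mem_convexHull'.2 ⟨fun u => c u x, hx, hS1 x, hSx x⟩
  · intro f x
    conv_lhs => rw [← hSx x]
    rw [aff_sum f s (fun u => c u x) (hS1 x)]

/-- The centroid of a finset. -/
def cen (F : Finset Pt3) : Pt3 := ∑ y ∈ F, ((F.card : ℝ)⁻¹) • y

lemma cen_aff {F : Finset Pt3} (hF : F.Nonempty) (f : Aff3) :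
    f (cen F) = (F.card : ℝ)⁻¹ * ∑ y ∈ F, f y := by
  have hc : (F.card : ℝ) ≠ 0 := by
    have := Finset.card_pos.2 hF
    positivity
  unfold cen
  rw [aff_sum f F (fun _ => (F.card : ℝ)⁻¹) (by simp [hc]), Finset.mul_sum]

lemma cen_mem {F : Finset Pt3} (hF : F.Nonempty) : cen F ∈ hull F := by
  have hc : (F.card : ℝ) ≠ 0 := by
    have := Finset.card_pos.2 hF
    positivity
  exact Finset.mem_convexHull'.2 ⟨fun _ => (F.card : ℝ)⁻¹, fun _ _ => by positivity,
    by simp [hc], rfl⟩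

/-- If the centroid of a coordinatized set `F` is in the hull of `G`, with `F ∪ G` coordinatized
then `F ⊆ G`. -/
lemma cen_sub {s F G : Finset Pt3} (hs : Coords s) (hF : F ⊆ s) (hG : G ⊆ s)
    (hx : F.Nonempty) (h : cen F ∈ hull G) : F ⊆ G := by
  intro u hu
  by_contra hn
  obtain ⟨f, f1, f0⟩ := hs u (hF hu)
  have h0 : f (cen F) = 0 :=
    hull_zero (fun v hv => f0 v (hG hv) (fun e => hn (e ▸ hv))) h
  rw [cen_aff hx, Finset.sum_eq_single u (fun v hv hvu => f0 v (hF hv) hvu)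
    (fun h => absurd hu h), f1] at h0
  have := Finset.card_pos.2 hx
  have : (0:ℝ) < (F.card : ℝ)⁻¹ := by positivity
  linarith

lemma near {V : Finset Pt3} {T : Finset (Finset Pt3)} (hT : IsTriangulation V T) {x y : Pt3}
    (hx : x ∈ hull V) (hy : y ∈ hull V) :
    ∃ σ ∈ T, x ∈ hull σ ∧ ∃ e : ℝ, 0 < e ∧ e < 1 ∧ AffineMap.lineMap x y e ∈ hull σ := by
  have hcont : Continuous (fun e : ℝ => (AffineMap.lineMap x y e : Pt3)) :=
    AffineMap.lineMap_continuous
  have h1 : ∀ᶠ e in nhdsWithin (0:ℝ) (Ioi 0), ∀ τ ∈ T, x ∉ hull τ →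
      (AffineMap.lineMap x y e : Pt3) ∉ hull τ := by
    rw [Filter.eventually_all_finset]
    intro τ _
    by_cases hxt : x ∈ hull τ
    · exact Filter.Eventually.of_forall fun e h => absurd hxt h
    · have ho : IsOpen (hull τ)ᶜ := (hull_compact τ).isClosed.isOpen_compl
      have : ∀ᶠ e in nhds (0:ℝ), (AffineMap.lineMap x y e : Pt3) ∈ (hull τ)ᶜ := by
        apply hcont.continuousAt.eventually_mem
        apply ho.mem_nhds
        simpa using hxt
      exact (this.filter_mono nhdsWithin_le_nhds).mono fun e he _ => he
  have h2 : ∀ᶠ e in nhdsWithin (0:ℝ) (Ioi 0), e ∈ Ioo (0:ℝ) 1 :=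
    Ioo_mem_nhdsGT one_pos
  obtain ⟨e, he1, he2⟩ := (h1.and h2).exists
  have hm : (AffineMap.lineMap x y e : Pt3) ∈ hull V := hull_line hx hy he2.1.le he2.2.le
  have hcov := hT.1.2.2
  have : (AffineMap.lineMap x y e : Pt3) ∈ ⋃ σ ∈ T, convexHull ℝ (σ : Set Pt3) := by
    rw [hcov]; exact hm
  simp only [mem_iUnion] at this
  obtain ⟨σ, hσ, hmem⟩ := this
  refine ⟨σ, hσ, ?_, e, he2.1, he2.2, hmem⟩
  by_contra hn
  exact he1 σ hσ hn hmem


section tri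
variable {V : Finset Pt3} {T : Finset (Finset Pt3)}

lemma tri_tet (hT : IsTriangulation V T) {σ : Finset Pt3} (h : σ ∈ T) : IsTet σ := (hT.1.1 σ h).1

lemma tri_sub (hT : IsTriangulation V T) {σ : Finset Pt3} (h : σ ∈ T) : σ ⊆ V := by
  have := (hT.1.1 σ h).2
  exact_mod_cast this

lemma tri_inter (hT : IsTriangulation V T) {σ τ : Finset Pt3} (h : σ ∈ T) (h' : τ ∈ T) {x : Pt3}
    (hx : x ∈ hull σ) (hx' : x ∈ hull τ) : x ∈ hull (σ ∩ τ) := by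
  have := hT.2 σ h τ h'
  show x ∈ convexHull ℝ ((σ ∩ τ : Finset Pt3) : Set Pt3)
  rw [← this]; exact ⟨hx, hx'⟩

def AllExt (V : Finset Pt3) : Prop := ∀ v ∈ V, v ∈ (hull V).extremePoints ℝ

lemma ext_line (hV : AllExt V) {v a b : Pt3} (hv : v ∈ V) (ha : a ∈ hull V) (hb : b ∈ hull V)
    {e : ℝ} (h0 : 0 < e) (h1 : e < 1) (h : AffineMap.lineMap a b e = v) : a = v ∧ b = v := by
  have := (mem_extremePoints.1 (hV v hv)).2 a ha b hb
  apply this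
  rw [openSegment_eq_image_lineMap]
  exact ⟨e, ⟨h0, h1⟩, h⟩

lemma not_wbtw (hV : AllExt V) {x y z : Pt3} (hx : x ∈ V) (hy : y ∈ V) (hz : z ∈ V)
    (hxy : x ≠ y) (hyz : y ≠ z) : ¬ Wbtw ℝ x y z := by
  rintro ⟨e, ⟨h0, h1⟩, h⟩
  rcases h0.eq_or_lt with h0 | h0
  · subst h0; simp at h; exact hxy h
  rcases h1.eq_or_lt with h1 | h1
  · subst h1; simp at h; exact hyz h.symm
  exact hxy (ext_line hV hy (mem_hull hx) (mem_hull hz) h0 h1 h).1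

lemma coords3 (hV : AllExt V) {F : Finset Pt3} (hF : F ⊆ V) (h3 : F.card = 3) : Coords F := by
  obtain ⟨x, y, z, hxy, hxz, hyz, rfl⟩ := Finset.card_eq_three.1 h3
  have hx : x ∈ V := hF (by simp)
  have hy : y ∈ V := hF (by simp)
  have hz : z ∈ V := hF (by simp)
  apply coords_of_ai
  have h : AffineIndependent ℝ ![x, y, z] := by
    rw [affineIndependent_iff_not_collinear_set]
    intro hc
    rcases hc.wbtw_or_wbtw_or_wbtw with h | h | h
    · exact not_wbtw hV hx hy hz hxy hyz h
    · exact not_wbtw hV hy hz hx hyz hxz.symm h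
    · exact not_wbtw hV hz hx hy hxz.symm hxy h
  have h2 := h.range
  have hr : Set.range ![x, y, z] = (({x, y, z} : Finset Pt3) : Set Pt3) := by
    ext p; simp [eq_comm]; tauto
  rw [hr] at h2
  exact h2

lemma tet_ne {σ : Finset Pt3} (hσ : IsTet σ) {f : Aff3} {v : Pt3} (hv : f v ≠ 0) :
    ∃ w ∈ σ, f w ≠ 0 := by
  obtain ⟨c, -, -, -, h⟩ := tet_bary hσ
  by_contra hn
  push Not at hn
  apply hv
  rw [h f v]
  exact Finset.sum_eq_zero fun u hu => by rw [hn u hu, mul_zero]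

lemma same_side (hT : IsTriangulation V T) {σ τ F : Finset Pt3} (hσ : σ ∈ T) (hτ : τ ∈ T)
    (hFσ : F ⊆ σ) (hFτ : F ⊆ τ) (h3 : F.card = 3) {f : Aff3} (hf : ∀ v ∈ F, f v = 0)
    {w w' : Pt3} (hw : w ∈ σ) (hw' : w' ∈ τ) (hfw : 0 < f w) (hfw' : 0 < f w') : σ = τ := by
  have hwF : w ∉ F := fun h => by have := hf w h; linarith
  have hne : F.Nonempty := Finset.card_pos.1 (by omega)
  have hσe : insert w F = σ := by
    apply Finset.eq_of_subset_of_card_le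
    · exact Finset.insert_subset hw hFσ
    · rw [Finset.card_insert_of_notMem hwF, h3, (tri_tet hT hσ).1]
  obtain ⟨c, c1, c0, cm, cf⟩ := tet_bary (tri_tet hT hσ)
  have hww : 0 < c w w' := by
    have := cf f w'
    rw [Finset.sum_eq_single w] at this
    · rw [this] at hfw'
      exact pos_of_mul_pos_left hfw' hfw.le
    · intro b hb hbw
      rw [hf b, mul_zero]
      rw [← hσe] at hb
      exact (Finset.mem_insert.1 hb).resolve_left hbw
    · intro h; exact absurd hw h
  have hcw : c w (cen F) = 0 := by
    rw [cen_aff hne, Finset.sum_eq_zero, mul_zero]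
    intro y hy
    exact c0 w hw y (hFσ hy) (fun h => hwF (h ▸ hy))
  have hcu : ∀ u ∈ F, 0 < c u (cen F) := by
    intro u hu
    rw [cen_aff hne, Finset.sum_eq_single u (fun b hb hbu => c0 u (hFσ hu) b (hFσ hb) hbu)
      (fun h => absurd hu h), c1 u (hFσ hu), h3]
    norm_num
  have h1 : ∀ᶠ e in nhdsWithin (0:ℝ) (Ioi 0), ∀ u ∈ F,
      0 < c u (AffineMap.lineMap (cen F) w' e) := by
    rw [Filter.eventually_all_finset]
    intro u hu
    have hcont : Continuous (fun e : ℝ => c u (AffineMap.lineMap (cen F) w' e : Pt3)) :=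
      (aff_cont (c u)).comp AffineMap.lineMap_continuous
    have : ∀ᶠ e in nhds (0:ℝ), c u (AffineMap.lineMap (cen F) w' e : Pt3) ∈ Ioi (0:ℝ) := by
      apply hcont.continuousAt.eventually_mem
      apply isOpen_Ioi.mem_nhds
      simpa using hcu u hu
    exact this.filter_mono nhdsWithin_le_nhds
  have h2 : ∀ᶠ e in nhdsWithin (0:ℝ) (Ioi 0), e ∈ Ioo (0:ℝ) 1 :=
    Ioo_mem_nhdsGT one_pos
  obtain ⟨e, he1, he2⟩ := (h1.and h2).exists
  set x : Pt3 := AffineMap.lineMap (cen F) w' e with hx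
  have hxw : 0 < c w x := by
    rw [hx, aff_line, hcw, mul_zero, zero_add]; exact mul_pos he2.1 hww
  have hxσ : x ∈ hull σ := by
    apply cm
    intro u hu
    rw [← hσe] at hu
    rcases Finset.mem_insert.1 hu with rfl | hu
    · exact hxw.le
    · exact (he1 u hu).le
  have hxτ : x ∈ hull τ :=
    hull_line (hull_mono hFτ (cen_mem hne)) (mem_hull hw') he2.1.le he2.2.le
  have hxi := tri_inter hT hσ hτ hxσ hxτ
  have hwτ : w ∈ τ := by
    by_contra hn
    have : c w x = 0 := hull_zero (fun v hv => by
      rw [Finset.mem_inter] at hv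
      exact c0 w hw v hv.1 (fun h => hn (h ▸ hv.2))) hxi
    linarith
  apply Finset.eq_of_subset_of_card_le
  · rw [← hσe]; exact Finset.insert_subset hwτ hFτ
  · rw [(tri_tet hT hσ).1, (tri_tet hT hτ).1]

lemma facet_one (hT : IsTriangulation V T) {F : Finset Pt3} (h3 : F.card = 3)
    (hex : ∃ σ ∈ T, F ⊆ σ) {f : Aff3} (hf : ∀ v ∈ V, 0 ≤ f v) (hne : ∃ v ∈ V, f v ≠ 0)
    (h0 : ∀ v ∈ F, f v = 0) : (T.filter (fun σ => F ⊆ σ)).card = 1 := by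
  obtain ⟨σ, hσ, hFσ⟩ := hex
  obtain ⟨v, -, hv⟩ := hne
  rw [Finset.card_eq_one]
  refine ⟨σ, ?_⟩
  ext τ
  simp only [Finset.mem_filter, Finset.mem_singleton]
  constructor
  · rintro ⟨hτ, hFτ⟩
    obtain ⟨w, hw, hfw⟩ := tet_ne (tri_tet hT hτ) hv
    obtain ⟨w', hw', hfw'⟩ := tet_ne (tri_tet hT hσ) hv
    exact same_side hT hτ hσ hFτ hFσ h3 h0 hw hw'
      (lt_of_le_of_ne (hf w (tri_sub hT hτ hw)) hfw.symm)
      (lt_of_le_of_ne (hf w' (tri_sub hT hσ hw')) hfw'.symm)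
  · rintro rfl; exact ⟨hσ, hFσ⟩

lemma facet_two (hT : IsTriangulation V T) {F : Finset Pt3} (h3 : F.card = 3)
    (hex : ∃ σ ∈ T, F ⊆ σ)
    (hb : ¬ ∃ f : Aff3, (∀ v ∈ V, 0 ≤ f v) ∧ (∃ v ∈ V, f v ≠ 0) ∧ (∀ v ∈ F, f v = 0)) :
    (T.filter (fun σ => F ⊆ σ)).card = 2 := by
  obtain ⟨σ, hσ, hFσ⟩ := hex
  have hne : F.Nonempty := Finset.card_pos.1 (by omega)
  obtain ⟨w, hw, hwF⟩ : ∃ w ∈ σ, w ∉ F := by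
    by_contra hn
    push Not at hn
    have := Finset.card_le_card (show σ ⊆ F from hn)
    rw [(tri_tet hT hσ).1] at this; omega
  obtain ⟨f, f1, f0⟩ := (tet_iff.1 (tri_tet hT hσ)).2 w hw
  have hfF : ∀ v ∈ F, f v = 0 := fun v hv => f0 v (hFσ hv) (fun h => hwF (h ▸ hv))
  have hwV := tri_sub hT hσ hw
  obtain ⟨v, hv, hfv⟩ : ∃ v ∈ V, f v < 0 := by
    by_contra hn
    push Not at hn
    exact hb ⟨f, hn, ⟨w, hwV, by rw [f1]; norm_num⟩, hfF⟩
  obtain ⟨τ, hτ, hcτ, e, he0, he1, hxτ⟩ := near hT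
    (hull_mono (hFσ.trans (tri_sub hT hσ)) (cen_mem hne)) (mem_hull hv)
  have hFi : F ⊆ σ ∩ τ := cen_sub (tet_iff.1 (tri_tet hT hσ)).2 hFσ Finset.inter_subset_left hne
    (tri_inter hT hσ hτ (hull_mono hFσ (cen_mem hne)) hcτ)
  have hFτ : F ⊆ τ := hFi.trans Finset.inter_subset_right
  obtain ⟨w', hw', hfw'⟩ : ∃ w' ∈ τ, f w' < 0 := by
    by_contra hn
    push Not at hn
    have h1 := hull_nonneg hn hxτ
    rw [aff_line, hull_zero hfF (cen_mem hne)] at h1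
    nlinarith
  have hστ : σ ≠ τ := by
    rintro rfl
    by_cases h : w' = w
    · subst h; linarith
    · have := f0 w' hw' h; linarith
  rw [Finset.card_eq_two]
  refine ⟨σ, τ, hστ, ?_⟩
  ext ρ
  simp only [Finset.mem_filter, Finset.mem_singleton, Finset.mem_insert]
  constructor
  · rintro ⟨hρ, hFρ⟩
    obtain ⟨u, hu, hfu⟩ := tet_ne (tri_tet hT hρ) hfv.ne
    rcases lt_or_gt_of_ne hfu with h | h
    · right
      refine same_side hT hρ hτ hFρ hFτ h3 (f := -f) ?_ hu hw' ?_ ?_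
      · intro v hv; simp [hfF v hv]
      · simpa using h
      · simpa using hfw'
    · left
      exact same_side hT hρ hσ hFρ hFσ h3 hfF hu hw h (by rw [f1]; norm_num)
  · rintro (rfl | rfl)
    · exact ⟨hσ, hFσ⟩
    · exact ⟨hτ, hFτ⟩

lemma facet_exists (hT : IsTriangulation V T) {F : Finset Pt3} (hFV : F ⊆ V) (hne : F.Nonempty)
    (hF : Coords F) {f : Aff3} (hf : ∀ v ∈ V, 0 ≤ f v)
    (h0 : ∀ v ∈ V, f v = 0 ↔ v ∈ F) : ∃ σ ∈ T, F ⊆ σ := by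
  have hc := hull_mono hFV (cen_mem hne)
  obtain ⟨σ, hσ, hcσ, -⟩ := near hT hc hc
  refine ⟨σ, hσ, ?_⟩
  have hfc : f (cen F) = 0 := hull_zero (fun v hv => (h0 v (hFV hv)).2 hv) (cen_mem hne)
  have := face_mem (fun v hv => hf v (tri_sub hT hσ hv)) hcσ hfc
  have h2 := cen_sub hF subset_rfl (fun v hv => by
    rw [Finset.mem_filter] at hv
    exact (h0 v (tri_sub hT hσ hv.1)).1 hv.2) hne this
  exact h2.trans (Finset.filter_subset _ _)

end tri


section cnt
variable {V B : Finset Pt3} {T : Finset (Finset Pt3)} {f : Aff3}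

/-- `B` is the set of vertices of the proper face of `conv V` exposed by `f`. -/
structure FaceOf (V B : Finset Pt3) (f : Aff3) : Prop where
  sub : B ⊆ V
  nn : ∀ v ∈ V, 0 ≤ f v
  iff : ∀ v ∈ V, (f v = 0 ↔ v ∈ B)
  ne : ∃ v ∈ V, f v ≠ 0

lemma FaceOf.zero (hB : FaceOf V B f) {x : Pt3} (hx : x ∈ hull B) : f x = 0 :=
  hull_zero (fun v hv => (hB.iff v (hB.sub hv)).2 hv) hx

lemma FaceOf.mem_inter (hB : FaceOf V B f) {σ : Finset Pt3} (hσ : σ ⊆ V) {x : Pt3}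
    (hx : x ∈ hull σ) (h0 : f x = 0) : x ∈ hull (σ ∩ B) := by
  refine hull_mono ?_ (face_mem (fun v hv => hB.nn v (hσ hv)) hx h0)
  intro v hv
  rw [Finset.mem_filter] at hv
  exact Finset.mem_inter.2 ⟨hv.1, (hB.iff v (hσ hv.1)).1 hv.2⟩

lemma FaceOf.exists_pos (hT : IsTriangulation V T) (hB : FaceOf V B f) {σ : Finset Pt3}
    (hσ : σ ∈ T) : ∃ w ∈ σ, 0 < f w ∧ w ∉ B := by
  obtain ⟨v, -, hv⟩ := hB.ne
  obtain ⟨w, hw, hfw⟩ := tet_ne (tri_tet hT hσ) hv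
  have hwV := tri_sub hT hσ hw
  exact ⟨w, hw, lt_of_le_of_ne (hB.nn w hwV) hfw.symm, fun h => hfw ((hB.iff w hwV).2 h)⟩

lemma FaceOf.card_le (hT : IsTriangulation V T) (hB : FaceOf V B f) {σ : Finset Pt3}
    (hσ : σ ∈ T) : (σ ∩ B).card ≤ 3 := by
  obtain ⟨w, hw, -, hwB⟩ := hB.exists_pos hT hσ
  have : (σ ∩ B) ⊂ σ := by
    refine ⟨Finset.inter_subset_left, fun h => hwB (Finset.mem_inter.1 (h hw)).2⟩
  have := Finset.card_lt_card this
  rw [(tri_tet hT hσ).1] at this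
  omega

lemma FaceOf.same (hT : IsTriangulation V T) (hB : FaceOf V B f) {σ τ F : Finset Pt3}
    (hσ : σ ∈ T) (hτ : τ ∈ T) (hF : F.card = 3) (hFB : F ⊆ B) (hFσ : F ⊆ σ) (hFτ : F ⊆ τ) :
    σ = τ := by
  obtain ⟨w, hw, hfw, -⟩ := hB.exists_pos hT hσ
  obtain ⟨w', hw', hfw', -⟩ := hB.exists_pos hT hτ
  exact same_side hT hσ hτ hFσ hFτ hF (fun v hv => (hB.iff v (hB.sub (hFB hv))).2 (hFB hv))
    hw hw' hfw hfw'

lemma ext_mem (hV : AllExt V) {s : Finset Pt3} (hs : s ⊆ V) {v : Pt3} (hv : v ∈ V)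
    (h : v ∈ hull s) : v ∈ s := by
  have h1 : v ∈ (hull s).extremePoints ℝ :=
    inter_extremePoints_subset_extremePoints_of_subset (hull_mono hs) ⟨h, hV v hv⟩
  have := extremePoints_convexHull_subset h1
  exact_mod_cast this

lemma level (l : Aff3) {x y z : Pt3} (h1 : l x < l y) (h2 : l y < l z) :
    ∃ e : ℝ, 0 < e ∧ e < 1 ∧ l (AffineMap.lineMap x z e) = l y := by
  refine ⟨(l y - l x) / (l z - l x), ?_, ?_, ?_⟩
  · apply div_pos <;> linarith
  · rw [div_lt_one] <;> linarith
  · rw [aff_line]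
    have : l z - l x ≠ 0 := by linarith
    field_simp
    ring

/-- `y` is the middle vertex (for `l`) of the trace of `σ` on `B`. -/
def Mid (B : Finset Pt3) (l : Aff3) (σ : Finset Pt3) (y : Pt3) : Prop :=
  y ∈ σ ∩ B ∧ ∃ x ∈ σ ∩ B, ∃ z ∈ σ ∩ B, l x < l y ∧ l y < l z

lemma mid_level_ne (hV : AllExt V) (l : Aff3) {x y z : Pt3} (hx : x ∈ V) (hy : y ∈ V) (hz : z ∈ V)
    (h1 : l x < l y) (h2 : l y < l z) {s : Finset Pt3} (hxs : x ∈ s) (hzs : z ∈ s) :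
    ∃ w ∈ hull s, l w = l y ∧ w ≠ y := by
  obtain ⟨e, he0, he1, he⟩ := level l h1 h2
  refine ⟨_, hull_line (mem_hull hxs) (mem_hull hzs) he0.le he1.le, he, ?_⟩
  intro h
  have := (ext_line hV hy (mem_hull hx) (mem_hull hz) he0 he1 h).1
  rw [this] at h1
  exact lt_irrefl _ h1

lemma mid_inj (hT : IsTriangulation V T) (hV : AllExt V) (hB : FaceOf V B f) (l : Aff3)
    {σ τ : Finset Pt3} (hσ : σ ∈ T) (hτ : τ ∈ T) (h3 : (σ ∩ B).card = 3) {y : Pt3}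
    (hmσ : Mid B l σ y) (hmτ : Mid B l τ y) : σ = τ := by
  obtain ⟨hy, x, hx, z, hz, hxy, hyz⟩ := hmσ
  obtain ⟨hy', x', hx', z', hz', hxy', hyz'⟩ := hmτ
  have hσV := tri_sub hT hσ
  have hτV := tri_sub hT hτ
  obtain ⟨w, hwτB, hlw, hwy⟩ := mid_level_ne hV l (hτV (Finset.mem_inter.1 hx').1)
    (hτV (Finset.mem_inter.1 hy').1) (hτV (Finset.mem_inter.1 hz').1) hxy' hyz'
    hx' hz'
  obtain ⟨u, hu, hfu, huB⟩ := hB.exists_pos hT hσ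
  obtain ⟨c, c1, c0, cm, cf⟩ := tet_bary (tri_tet hT hσ)
  have hxy_ne : x ≠ y := fun h => by rw [h] at hxy; exact lt_irrefl _ hxy
  have hyz_ne : y ≠ z := fun h => by rw [h] at hyz; exact lt_irrefl _ hyz
  have hxz_ne : x ≠ z := fun h => by rw [h] at hxy; linarith
  have hF : ({x, y, z} : Finset Pt3) = σ ∩ B := by
    apply Finset.eq_of_subset_of_card_le
    · intro p hp
      simp only [Finset.mem_insert, Finset.mem_singleton] at hp
      rcases hp with rfl | rfl | rfl <;> assumption
    · rw [h3, Finset.card_eq_three.2 ⟨x, y, z, hxy_ne, hxz_ne, hyz_ne, rfl⟩]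
  have hxσ := (Finset.mem_inter.1 hx).1
  have hyσ := (Finset.mem_inter.1 hy).1
  have hzσ := (Finset.mem_inter.1 hz).1
  have hux : u ≠ x := fun h => huB (h ▸ (Finset.mem_inter.1 hx).2)
  have huy : u ≠ y := fun h => huB (h ▸ (Finset.mem_inter.1 hy).2)
  have huz : u ≠ z := fun h => huB (h ▸ (Finset.mem_inter.1 hz).2)
  have hσe : σ = {u, x, y, z} := by
    symm
    apply Finset.eq_of_subset_of_card_le
    · intro p hp
      simp only [Finset.mem_insert, Finset.mem_singleton] at hp
      rcases hp with rfl | rfl | rfl | rfl <;> assumption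
    · rw [(tri_tet hT hσ).1, Finset.card_insert_of_notMem (by simp [hux, huy, huz]),
        Finset.card_eq_three.2 ⟨x, y, z, hxy_ne, hxz_ne, hyz_ne, rfl⟩]
  have hsum : ∀ (g : Aff3) (p : Pt3),
      g p = c u p * g u + (c x p * g x + (c y p * g y + c z p * g z)) := by
    intro g p
    rw [cf g p, hσe, Finset.sum_insert (by simp [hux, huy, huz]),
      Finset.sum_insert (by simp [hxy_ne, hxz_ne]), Finset.sum_insert (by simp [hyz_ne]),
      Finset.sum_singleton]
  have hfB : ∀ v ∈ σ ∩ B, f v = 0 := fun v hv =>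
    (hB.iff v (hσV (Finset.mem_inter.1 hv).1)).2 (Finset.mem_inter.1 hv).2
  have hcu : c u w = 0 := by
    have h1 := hsum f w
    rw [hB.zero (hull_mono Finset.inter_subset_right hwτB), hfB x hx, hfB y hy, hfB z hz] at h1
    have : c u w * f u = 0 := by linarith
    rcases mul_eq_zero.1 this with h | h
    · exact h
    · linarith
  have hone : c x w + c y w + c z w = 1 := by
    have := hsum (AffineMap.const ℝ Pt3 (1:ℝ)) w
    simp [hcu] at this
    linarith
  have hl : c x w * (l y - l x) = c z w * (l z - l y) := by
    have h1 := hsum l w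
    rw [hcu, hlw] at h1
    have h2 : c y w = 1 - c x w - c z w := by linarith
    rw [h2] at h1
    linarith
  have hwV : w ∈ hull V := hull_mono (Finset.inter_subset_left.trans hτV) hwτB
  -- a small parameter
  obtain ⟨e, he0, he1, heb⟩ : ∃ e : ℝ, 0 < e ∧ e < 1 ∧ |e * (1 - c y w)| < 1 := by
    have hp : 0 < 2 + |c y w| := by positivity
    refine ⟨1 / (2 + |c y w|), by positivity, ?_, ?_⟩
    · rw [div_lt_one hp]; have := abs_nonneg (c y w); linarith
    · rw [abs_mul, abs_of_pos (by positivity : 0 < 1 / (2 + |c y w|)), one_div, inv_mul_lt_iff₀ hp]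
      have h1 := abs_sub (1:ℝ) (c y w)
      rw [abs_one] at h1
      linarith
  rw [abs_lt] at heb
  have hcoord : ∀ s : ℝ, (0 ≤ s * c x w) → (0 ≤ s * c z w) → 0 ≤ 1 - s * (1 - c y w) →
      (AffineMap.lineMap y w s : Pt3) ∈ hull σ := by
    intro s h1 h2 h3
    apply cm
    intro p hp
    rw [hσe] at hp
    simp only [Finset.mem_insert, Finset.mem_singleton] at hp
    rw [aff_line]
    rcases hp with rfl | rfl | rfl | rfl
    · rw [hcu, c0 p hu y hyσ huy.symm]; simp
    · rw [c0 p hxσ y hyσ hxy_ne.symm]; simpa using h1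
    · rw [c1 p hyσ]; linarith
    · rw [c0 p hzσ y hyσ hyz_ne]; simpa using h2
  have hpx : 0 < l y - l x := by linarith
  have hpz : 0 < l z - l y := by linarith
  have hpos : 0 < c x w := by
    by_contra hn
    push Not at hn
    have hzn : c z w ≤ 0 := by
      by_contra h
      push Not at h
      have := mul_pos h hpz
      nlinarith
    have hp := hcoord (-e) (by nlinarith) (by nlinarith) (by linarith)
    have h2 : (AffineMap.lineMap (AffineMap.lineMap y w (-e) : Pt3) w (e / (1 + e)) : Pt3) = y := by
      have : 1 + e ≠ 0 := by positivity
      ext i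
      simp [AffineMap.lineMap_apply]
      field_simp
      ring
    have := (ext_line hV (hσV hyσ) (hull_mono hσV hp) hwV (by positivity)
      (by rw [div_lt_one] <;> linarith) h2).2
    exact hwy this
  have hposz : 0 < c z w := by
    have := mul_pos hpos hpx
    rw [hl] at this
    exact pos_of_mul_pos_left this hpz.le
  have hpσ := hcoord e (by positivity) (by positivity) (by linarith)
  have hpτ : (AffineMap.lineMap y w e : Pt3) ∈ hull τ :=
    hull_line (mem_hull (Finset.mem_inter.1 hy').1) (hull_mono Finset.inter_subset_left hwτB)
      he0.le he1.le
  have hpi := tri_inter hT hσ hτ hpσ hpτ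
  have hxτ : x ∈ τ := by
    by_contra hn
    have : c x (AffineMap.lineMap y w e) = 0 := hull_zero (fun v hv => by
      rw [Finset.mem_inter] at hv
      exact c0 x hxσ v hv.1 (fun h => hn (h ▸ hv.2))) hpi
    rw [aff_line, c0 x hxσ y hyσ hxy_ne.symm] at this
    nlinarith
  have hzτ : z ∈ τ := by
    by_contra hn
    have : c z (AffineMap.lineMap y w e) = 0 := hull_zero (fun v hv => by
      rw [Finset.mem_inter] at hv
      exact c0 z hzσ v hv.1 (fun h => hn (h ▸ hv.2))) hpi
    rw [aff_line, c0 z hzσ y hyσ hyz_ne] at this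
    nlinarith
  refine hB.same hT hσ hτ h3 Finset.inter_subset_right Finset.inter_subset_left ?_
  rw [← hF]
  intro p hp
  simp only [Finset.mem_insert, Finset.mem_singleton] at hp
  rcases hp with rfl | rfl | rfl
  · exact hxτ
  · exact (Finset.mem_inter.1 hy').1
  · exact hzτ

lemma mid_surj (hT : IsTriangulation V T) (hV : AllExt V) (hB : FaceOf V B f) (l : Aff3)
    (hl : Set.InjOn l B) {x y z : Pt3} (hx : x ∈ B) (hy : y ∈ B) (hz : z ∈ B)
    (hxy : l x < l y) (hyz : l y < l z) : ∃ σ ∈ T, (σ ∩ B).card = 3 ∧ Mid B l σ y := by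
  obtain ⟨w, hwB, hlw, hwy⟩ := mid_level_ne hV l (hB.sub hx) (hB.sub hy) (hB.sub hz) hxy hyz
    hx hz
  obtain ⟨σ, hσ, hyσ, e, he0, he1, hp⟩ := near hT (mem_hull (hB.sub hy)) (hull_mono hB.sub hwB)
  have hσV := tri_sub hT hσ
  have hyσ' : y ∈ σ := ext_mem hV hσV (hB.sub hy) hyσ
  have hyi : y ∈ σ ∩ B := Finset.mem_inter.2 ⟨hyσ', hy⟩
  have hpB := hB.mem_inter hσV hp (hB.zero (hull_line (mem_hull hy) hwB he0.le he1.le))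
  have key : ∀ g : Aff3, (∀ v, g v = l v - l y ∨ g v = l y - l v) →
      g (AffineMap.lineMap y w e) = 0 → ¬ ∀ v ∈ σ ∩ B, 0 ≤ g v := by
    intro g hg g0 hn
    have h1 := face_mem hn hpB g0
    have h2 : ∀ v ∈ (σ ∩ B).filter (fun v => g v = 0), v ∈ ({y} : Finset Pt3) := by
      intro v hv
      rw [Finset.mem_filter, Finset.mem_inter] at hv
      rw [Finset.mem_singleton]
      apply hl hv.1.2 hy
      rcases hg v with h | h <;> linarith [hv.2]
    have h3 := hull_mono h2 h1
    have h4 : (AffineMap.lineMap y w e : Pt3) = y := by simpa [hull] using h3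
    have := (ext_line hV (hB.sub hy) (mem_hull (hB.sub hy)) (hull_mono hB.sub hwB) he0 he1 h4).2
    exact hwy this
  obtain ⟨x', hx', hxy'⟩ : ∃ x' ∈ σ ∩ B, l x' < l y := by
    by_contra hn
    push Not at hn
    refine key (l - AffineMap.const ℝ Pt3 (l y)) (fun v => ?_) ?_ (fun v hv => ?_)
    · left; simp
    · simp [hlw]
    · simpa using hn v hv
  obtain ⟨z', hz', hyz'⟩ : ∃ z' ∈ σ ∩ B, l y < l z' := by
    by_contra hn
    push Not at hn
    refine key (AffineMap.const ℝ Pt3 (l y) - l) (fun v => ?_) ?_ (fun v hv => ?_)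
    · right; simp
    · simp [hlw]
    · simpa using hn v hv
  refine ⟨σ, hσ, le_antisymm (hB.card_le hT hσ) ?_, hyi, x', hx', z', hz', hxy', hyz'⟩
  have h1 : x' ≠ y := fun h => by rw [h] at hxy'; exact lt_irrefl _ hxy'
  have h2 : y ≠ z' := fun h => by rw [h] at hyz'; exact lt_irrefl _ hyz'
  have h3 : x' ≠ z' := fun h => by rw [h] at hxy'; linarith
  refine (Finset.card_eq_three.2 ⟨x', y, z', h1, h3, h2, rfl⟩ :
    ({x', y, z'} : Finset Pt3).card = 3).symm.le.trans ?_
  apply Finset.card_le_card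
  intro p hp
  simp only [Finset.mem_insert, Finset.mem_singleton] at hp
  rcases hp with rfl | rfl | rfl <;> assumption

lemma exists_inj (B : Finset Pt3) : ∃ l : Aff3, Set.InjOn l B := by
  obtain ⟨g, hg⟩ := Module.exists_dual_forall_apply_ne_zero (K := ℝ) (M := Pt3)
    (ι := {p : B × B // p.1 ≠ p.2}) (fun p => (p.1.1 : Pt3) - p.1.2)
    (fun p => sub_ne_zero.2 (fun h => p.2 (Subtype.ext h)))
  refine ⟨g.toAffineMap, ?_⟩
  intro x hx y hy hxy
  by_contra hne
  have := hg ⟨(⟨x, hx⟩, ⟨y, hy⟩), fun h => hne (by simpa using h)⟩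
  apply this
  simp only [map_sub]
  simpa [sub_eq_zero] using hxy

lemma mid_exists (l : Aff3) (hl : Set.InjOn l B) {σ : Finset Pt3} (h3 : (σ ∩ B).card = 3) :
    ∃ y, Mid B l σ y := by
  obtain ⟨x, y, z, hxy, hxz, hyz, he⟩ := Finset.card_eq_three.1 h3
  have hx : x ∈ σ ∩ B := by rw [he]; simp
  have hy : y ∈ σ ∩ B := by rw [he]; simp
  have hz : z ∈ σ ∩ B := by rw [he]; simp
  have hB : ∀ p ∈ σ ∩ B, p ∈ (B : Set Pt3) := fun p hp => by
    exact_mod_cast (Finset.mem_inter.1 hp).2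
  have h1 : l x ≠ l y := fun h => hxy (hl (hB x hx) (hB y hy) h)
  have h2 : l x ≠ l z := fun h => hxz (hl (hB x hx) (hB z hz) h)
  have h3 : l y ≠ l z := fun h => hyz (hl (hB y hy) (hB z hz) h)
  rcases lt_or_gt_of_ne h1 with h1 | h1 <;> rcases lt_or_gt_of_ne h2 with h2 | h2 <;>
    rcases lt_or_gt_of_ne h3 with h3 | h3
  · exact ⟨y, hy, x, hx, z, hz, h1, h3⟩
  · exact ⟨z, hz, x, hx, y, hy, h2, h3⟩
  · linarith
  · exact ⟨x, hx, z, hz, y, hy, h2, h1⟩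
  · exact ⟨x, hx, y, hy, z, hz, h1, h2⟩
  · linarith
  · exact ⟨z, hz, y, hy, x, hx, h3, h2⟩
  · exact ⟨y, hy, z, hz, x, hx, h3, h1⟩

lemma mid_unique (l : Aff3) {σ : Finset Pt3} (h3 : (σ ∩ B).card = 3) {y y' : Pt3}
    (h : Mid B l σ y) (h' : Mid B l σ y') : y = y' := by
  obtain ⟨hy, x, hx, z, hz, hxy, hyz⟩ := h
  obtain ⟨hy', x', hx', z', hz', hxy', hyz'⟩ := h'
  have h1 : x ≠ y := fun h => by rw [h] at hxy; exact lt_irrefl _ hxy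
  have h2 : y ≠ z := fun h => by rw [h] at hyz; exact lt_irrefl _ hyz
  have h4 : x ≠ z := fun h => by rw [h] at hxy; linarith
  have hF : ({x, y, z} : Finset Pt3) = σ ∩ B := by
    apply Finset.eq_of_subset_of_card_le
    · intro p hp
      simp only [Finset.mem_insert, Finset.mem_singleton] at hp
      rcases hp with rfl | rfl | rfl <;> assumption
    · rw [h3, Finset.card_eq_three.2 ⟨x, y, z, h1, h4, h2, rfl⟩]
  rw [← hF] at hy' hx' hz'
  simp only [Finset.mem_insert, Finset.mem_singleton] at hy' hx' hz'
  rcases hy' with rfl | rfl | rfl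
  · rcases hx' with rfl | rfl | rfl <;> linarith
  · rfl
  · rcases hz' with rfl | rfl | rfl <;> linarith

theorem face_count (hT : IsTriangulation V T) (hV : AllExt V) (hB : FaceOf V B f)
    (h2 : 2 ≤ B.card) : (T.filter (fun σ => (σ ∩ B).card = 3)).card = B.card - 2 := by
  obtain ⟨l, hl⟩ := exists_inj B
  have hne : B.Nonempty := Finset.card_pos.1 (by omega)
  obtain ⟨a, ha, hamin⟩ := B.exists_min_image l hne
  obtain ⟨b, hb, hbmax⟩ := B.exists_max_image l hne
  have hab : a ≠ b := by
    rintro rfl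
    obtain ⟨p, hp, q, hq, hpq⟩ := Finset.one_lt_card.1 (by omega : 1 < B.card)
    apply hpq
    apply hl hp hq
    linarith [hamin p hp, hbmax p hp, hamin q hq, hbmax q hq]
  have hY : ((B.erase a).erase b).card = B.card - 2 := by
    rw [Finset.card_erase_of_mem (Finset.mem_erase.2 ⟨hab.symm, hb⟩), Finset.card_erase_of_mem ha]
    omega
  rw [← hY]
  have hmid : ∀ σ ∈ T.filter (fun σ => (σ ∩ B).card = 3), ∃ y, Mid B l σ y := fun σ hσ =>
    mid_exists l hl (Finset.mem_filter.1 hσ).2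
  choose mid hmid using hmid
  refine Finset.card_bij mid ?_ ?_ ?_
  · intro σ hσ
    obtain ⟨hy, x, hx, z, hz, hxy, hyz⟩ := hmid σ hσ
    rw [Finset.mem_inter] at hx hy hz
    refine Finset.mem_erase.2 ⟨?_, Finset.mem_erase.2 ⟨?_, hy.2⟩⟩
    · intro h; rw [h] at hyz; linarith [hbmax z hz.2]
    · intro h; rw [h] at hxy; linarith [hamin x hx.2]
  · intro σ hσ τ hτ h
    have h1 := hmid σ hσ
    have h2 := hmid τ hτ
    rw [← h] at h2
    rw [Finset.mem_filter] at hσ hτ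
    exact mid_inj hT hV hB l hσ.1 hτ.1 hσ.2 h1 h2
  · intro y hy
    rw [Finset.mem_erase, Finset.mem_erase] at hy
    obtain ⟨hyb, hya, hyB⟩ := hy
    have h1 : l a < l y := lt_of_le_of_ne (hamin y hyB) fun h => hya (hl hyB ha h.symm)
    have h2 : l y < l b := lt_of_le_of_ne (hbmax y hyB) fun h => hyb (hl hyB hb h)
    obtain ⟨σ, hσ, h3, hm⟩ := mid_surj hT hV hB l hl ha hyB hb h1 h2
    have hσ' : σ ∈ T.filter (fun σ => (σ ∩ B).card = 3) := Finset.mem_filter.2 ⟨hσ, h3⟩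
    exact ⟨σ, hσ', mid_unique l h3 (hmid σ hσ') hm⟩

end cnt


/-- The combinatorial-geometric interface: a geometric `m`-antiprism whose vertices are
`W p`, `p` an integer modulo `2 m`; even indices form the bottom cap, odd indices the top cap. -/
structure Anti (m : ℕ) (V Bot Top : Finset Pt3) (W : ℤ → Pt3) : Prop where
  hm : 3 ≤ m
  mem : ∀ x, x ∈ V ↔ ∃ p, W p = x
  memB : ∀ x, x ∈ Bot ↔ ∃ p, Even p ∧ W p = x
  memT : ∀ x, x ∈ Top ↔ ∃ p, Odd p ∧ W p = x
  eq_iff : ∀ p q, W p = W q ↔ (2 * m : ℤ) ∣ p - q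
  ext : AllExt V
  bot : ∃ f, FaceOf V Bot f
  top : ∃ f, FaceOf V Top f
  tri : ∀ p, ∃ f, FaceOf V {W p, W (p + 1), W (p + 2)} f
  complete : ∀ f : Aff3, (∀ v ∈ V, 0 ≤ f v) → (∃ v ∈ V, f v ≠ 0) →
    ∃ S, (S = Bot ∨ S = Top ∨ ∃ p, S = {W p, W (p + 1), W (p + 2)}) ∧ ∀ v ∈ V, f v = 0 → v ∈ S
  cardB : Bot.card = m
  cardT : Top.card = m

section anti
variable {m : ℕ} {V Bot Top : Finset Pt3} {W : ℤ → Pt3} {T : Finset (Finset Pt3)}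

lemma Anti.ne_of (h : Anti m V Bot Top W) {p q : ℤ} (h1 : p ≠ q) (h2 : |p - q| < 6) :
    W p ≠ W q := by
  intro he
  have hm := h.hm
  have := Int.eq_zero_of_abs_lt_dvd ((h.eq_iff p q).1 he) (by omega)
  omega

lemma Anti.disj (h : Anti m V Bot Top W) {x : Pt3} (hb : x ∈ Bot) (ht : x ∈ Top) : False := by
  obtain ⟨p, hp, rfl⟩ := (h.memB x).1 hb
  obtain ⟨q, hq, hpq⟩ := (h.memT _).1 ht
  obtain ⟨k, hk⟩ := (h.eq_iff q p).1 hpq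
  obtain ⟨a, ha⟩ := hp
  obtain ⟨b, hb⟩ := hq
  have : (2:ℤ) ∣ q - p := ⟨m * k, by rw [hk]; ring⟩
  omega

lemma Anti.union (h : Anti m V Bot Top W) : V = Bot ∪ Top := by
  ext x
  rw [h.mem, Finset.mem_union, h.memB, h.memT]
  constructor
  · rintro ⟨p, rfl⟩
    rcases Int.even_or_odd p with hp | hp
    · exact Or.inl ⟨p, hp, rfl⟩
    · exact Or.inr ⟨p, hp, rfl⟩
  · rintro (⟨p, -, rfl⟩ | ⟨p, -, rfl⟩) <;> exact ⟨p, rfl⟩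

lemma Anti.card_split (h : Anti m V Bot Top W) {σ : Finset Pt3} (hσ : σ ⊆ V) :
    (σ ∩ Bot).card + (σ ∩ Top).card = σ.card := by
  rw [← Finset.card_union_of_disjoint]
  · rw [← Finset.inter_union_distrib_left, ← h.union, Finset.inter_eq_left.2 hσ]
  · rw [Finset.disjoint_left]
    intro x hx hy
    exact h.disj (Finset.mem_inter.1 hx).2 (Finset.mem_inter.1 hy).2

lemma Anti.W_mem (h : Anti m V Bot Top W) (p : ℤ) : W p ∈ V := (h.mem _).2 ⟨p, rfl⟩

lemma Anti.tri_card (h : Anti m V Bot Top W) (p : ℤ) :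
    ({W p, W (p + 1), W (p + 2)} : Finset Pt3).card = 3 :=
  Finset.card_eq_three.2 ⟨_, _, _, h.ne_of (by omega) (by simp),
    h.ne_of (by omega) (by simp), h.ne_of (by omega) (by ring_nf; simp), rfl⟩

/-- Boundary doors at `W p`. -/
lemma Anti.door (h : Anti m V Bot Top W) {p : ℤ} (hp : Even p) {x y : Pt3} (hx : x ∈ Top)
    (hy : y ∈ Top) (hxy : x ≠ y) {f : Aff3} (h0 : ∀ v ∈ V, 0 ≤ f v) (h1 : ∃ v ∈ V, f v ≠ 0)
    (h2 : ∀ v ∈ ({W p, x, y} : Finset Pt3), f v = 0) :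
    (x = W (p - 1) ∧ y = W (p + 1)) ∨ (y = W (p - 1) ∧ x = W (p + 1)) := by
  have hTV : Top ⊆ V := by rw [h.union]; exact Finset.subset_union_right
  obtain ⟨S, hS, hSub⟩ := h.complete f h0 h1
  have hxS := hSub x (hTV hx) (h2 x (by simp))
  have hyS := hSub y (hTV hy) (h2 y (by simp))
  have hbS := hSub (W p) (h.W_mem p) (h2 _ (by simp))
  have hbB : W p ∈ Bot := (h.memB _).2 ⟨p, hp, rfl⟩
  rcases hS with rfl | rfl | ⟨r, rfl⟩
  · exact (h.disj hxS hx).elim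
  · exact (h.disj hbB hbS).elim
  · simp only [Finset.mem_insert, Finset.mem_singleton] at hxS hyS hbS
    rcases Int.even_or_odd r with hr | hr
    · have e1 : W r ∈ Bot := (h.memB _).2 ⟨r, hr, rfl⟩
      have e2 : W (r + 2) ∈ Bot := (h.memB _).2 ⟨r + 2, hr.add even_two, rfl⟩
      have hx' : x = W (r + 1) := by
        rcases hxS with rfl | rfl | rfl
        · exact (h.disj e1 hx).elim
        · rfl
        · exact (h.disj e2 hx).elim
      have hy' : y = W (r + 1) := by
        rcases hyS with rfl | rfl | rfl
        · exact (h.disj e1 hy).elim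
        · rfl
        · exact (h.disj e2 hy).elim
      exact (hxy (hx'.trans hy'.symm)).elim
    · have e1 : W r ∈ Top := (h.memT _).2 ⟨r, hr, rfl⟩
      have e2 : W (r + 2) ∈ Top := (h.memT _).2 ⟨r + 2, hr.add_even even_two, rfl⟩
      have e3 : W (r + 1) ∈ Bot := (h.memB _).2 ⟨r + 1, hr.add_one, rfl⟩
      have hb' : W p = W (r + 1) := by
        rcases hbS with hh | hh | hh
        · exact (h.disj hbB (hh ▸ e1)).elim
        · exact hh
        · exact (h.disj hbB (hh ▸ e2)).elim
      have hd := (h.eq_iff _ _).1 hb'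
      have q1 : W (p - 1) = W r := (h.eq_iff _ _).2 (by convert hd using 1; ring)
      have q2 : W (p + 1) = W (r + 2) := (h.eq_iff _ _).2 (by convert hd using 1; ring)
      rw [q1, q2]
      rcases hxS with rfl | rfl | rfl
      · rcases hyS with rfl | rfl | rfl
        · exact (hxy rfl).elim
        · exact (h.disj e3 hy).elim
        · exact Or.inl ⟨rfl, rfl⟩
      · exact (h.disj e3 hx).elim
      · rcases hyS with rfl | rfl | rfl
        · exact Or.inr ⟨rfl, rfl⟩
        · exact (h.disj e3 hy).elim
        · exact (hxy rfl).elim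

lemma Anti.sperner (h : Anti m V Bot Top W) (hT : IsTriangulation V T) {p : ℤ} (hp : Even p)
    {P : Finset Pt3} (hP : P ⊆ Top) (h1 : W (p - 1) ∈ P) (h2 : W (p + 1) ∉ P) :
    ∃ σ ∈ T, (σ ∩ Bot).card = 2 ∧ ∃ x ∈ P, ∃ y ∈ Top, y ∉ P ∧ x ∈ σ ∧ y ∈ σ := by
  by_contra hcon
  push Not at hcon
  set Q := Top \ P with hQ
  set b := W p with hb
  have hbB : b ∈ Bot := (h.memB _).2 ⟨p, hp, rfl⟩
  have hTV : Top ⊆ V := by rw [h.union]; exact Finset.subset_union_right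
  have ht2 : W (p + 1) ∈ Top := (h.memT _).2 ⟨_, hp.add_one, rfl⟩
  have ht2Q : W (p + 1) ∈ Q := Finset.mem_sdiff.2 ⟨ht2, h2⟩
  have hcard : ∀ z ∈ P ×ˢ Q, ({b, z.1, z.2} : Finset Pt3).card = 3 := by
    intro z hz
    rw [Finset.mem_product] at hz
    have hz2 := Finset.mem_sdiff.1 hz.2
    refine Finset.card_eq_three.2 ⟨b, z.1, z.2, ?_, ?_, ?_, rfl⟩
    · intro e; exact h.disj hbB (e ▸ hP hz.1)
    · intro e; exact h.disj hbB (e ▸ hz2.1)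
    · intro e; exact hz2.2 (e ▸ hz.1)
  have hdc := Finset.sum_card_bipartiteAbove_eq_sum_card_bipartiteBelow (s := T) (t := P ×ˢ Q)
    (fun σ z => ({b, z.1, z.2} : Finset Pt3) ⊆ σ)
  have hL : Even (∑ σ ∈ T, ((P ×ˢ Q).bipartiteAbove
      (fun σ z => ({b, z.1, z.2} : Finset Pt3) ⊆ σ) σ).card) := by
    apply Finset.even_sum
    intro σ hσ
    by_cases hbσ : b ∈ σ
    · have he : (P ×ˢ Q).bipartiteAbove (fun σ z => ({b, z.1, z.2} : Finset Pt3) ⊆ σ) σ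
          = (σ ∩ P) ×ˢ (σ ∩ Q) := by
        ext z
        simp only [Finset.bipartiteAbove, Finset.mem_filter, Finset.mem_product, Finset.mem_inter,
          Finset.insert_subset_iff, Finset.singleton_subset_iff]
        tauto
      rw [he, Finset.card_product]
      have hs := h.card_split (tri_sub hT hσ)
      rw [(tri_tet hT hσ).1] at hs
      have hPQ : (σ ∩ P).card + (σ ∩ Q).card = (σ ∩ Top).card := by
        rw [← Finset.card_union_of_disjoint]
        · rw [← Finset.inter_union_distrib_left, hQ, Finset.union_sdiff_of_subset hP]
        · rw [Finset.disjoint_left]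
          intro x hx hy
          exact (Finset.mem_sdiff.1 (Finset.mem_inter.1 hy).2).2 (Finset.mem_inter.1 hx).2
      have hpos : 0 < (σ ∩ Bot).card := Finset.card_pos.2 ⟨b, Finset.mem_inter.2 ⟨hbσ, hbB⟩⟩
      have h2 : (σ ∩ Bot).card = 2 → (σ ∩ P).card = 0 ∨ (σ ∩ Q).card = 0 := by
        intro h2
        by_contra hn
        push Not at hn
        obtain ⟨x, hx⟩ := Finset.card_pos.1 (Nat.pos_of_ne_zero hn.1)
        obtain ⟨y, hy⟩ := Finset.card_pos.1 (Nat.pos_of_ne_zero hn.2)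
        rw [Finset.mem_inter] at hx hy
        have hyQ := Finset.mem_sdiff.1 hy.2
        exact hcon σ hσ h2 x hx.2 y hyQ.1 hyQ.2 hx.1 hy.1
      generalize (σ ∩ P).card = α at *
      generalize (σ ∩ Q).card = β at *
      generalize (σ ∩ Bot).card = γ at *
      have hα : α ≤ 3 := by omega
      have hβ : β ≤ 3 := by omega
      interval_cases α <;> interval_cases β <;> first | decide | (exfalso; omega)
    · have he : (P ×ˢ Q).bipartiteAbove (fun σ z => ({b, z.1, z.2} : Finset Pt3) ⊆ σ) σ = ∅ := by
        apply Finset.filter_eq_empty_iff.2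
        intro z _ hz
        exact hbσ (hz (by simp))
      rw [he]; simp
  rw [hdc] at hL
  have hmem : (W (p - 1), W (p + 1)) ∈ P ×ˢ Q := Finset.mem_product.2 ⟨h1, ht2Q⟩
  rw [← Finset.add_sum_erase _ _ hmem] at hL
  have hrest : Even (∑ z ∈ (P ×ˢ Q).erase (W (p - 1), W (p + 1)), (T.bipartiteBelow
      (fun σ z => ({b, z.1, z.2} : Finset Pt3) ⊆ σ) z).card) := by
    apply Finset.even_sum
    intro z hz
    rw [Finset.mem_erase] at hz
    have hz' := Finset.mem_product.1 hz.2
    have hz2 := Finset.mem_sdiff.1 hz'.2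
    by_cases hex : ∃ σ ∈ T, ({b, z.1, z.2} : Finset Pt3) ⊆ σ
    · have : (T.bipartiteBelow (fun σ z => ({b, z.1, z.2} : Finset Pt3) ⊆ σ) z).card = 2 := by
        refine facet_two hT (hcard z hz.2) hex ?_
        rintro ⟨f, f0, f1, f2⟩
        rcases h.door hp (hP hz'.1) hz2.1 (fun e => hz2.2 (e ▸ hz'.1)) f0 f1 f2 with ⟨e1, e2⟩ | ⟨e1, e2⟩
        · exact hz.1 (Prod.ext e1 e2)
        · exact h2 (e2 ▸ hz'.1)
      rw [this]; exact even_two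
    · have : T.bipartiteBelow (fun σ z => ({b, z.1, z.2} : Finset Pt3) ⊆ σ) z = ∅ := by
        apply Finset.filter_eq_empty_iff.2
        intro σ hσ hz
        exact hex ⟨σ, hσ, hz⟩
      rw [this]; simp
  have hone : (T.bipartiteBelow (fun σ z => ({b, z.1, z.2} : Finset Pt3) ⊆ σ)
      (W (p - 1), W (p + 1))).card = 1 := by
    obtain ⟨f, hf⟩ := h.tri (p - 1)
    have he : ({W (p - 1), W (p - 1 + 1), W (p - 1 + 2)} : Finset Pt3)
        = {b, W (p - 1), W (p + 1)} := by
      rw [show p - 1 + 1 = p by ring, show p - 1 + 2 = p + 1 by ring, ← hb]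
      ext x; simp; tauto
    rw [he] at hf
    have hF3 := hcard _ hmem
    exact facet_one hT hF3 (facet_exists hT hf.sub (by simp) (coords3 h.ext hf.sub hF3) hf.nn
      (fun v hv => hf.iff v hv)) hf.nn hf.ne (fun v hv => (hf.iff v (hf.sub hv)).2 hv)
  rw [hone] at hL
  obtain ⟨a, ha⟩ := hrest
  obtain ⟨c, hc⟩ := hL
  omega

/-- The graph on top vertices given by the mixed tetrahedra. -/
def mixGraph (Bot Top : Finset Pt3) (T : Finset (Finset Pt3)) : SimpleGraph Top where
  Adj x y := x ≠ y ∧ ∃ σ ∈ T, (σ ∩ Bot).card = 2 ∧ (x : Pt3) ∈ σ ∧ (y : Pt3) ∈ σ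
  symm := ⟨fun _ _ ⟨h, σ, hσ, h2, hx, hy⟩ => ⟨h.symm, σ, hσ, h2, hy, hx⟩⟩
  loopless := ⟨fun _ h => h.1 rfl⟩

lemma Anti.topmem (h : Anti m V Bot Top W) (k : ℤ) : W (2 * k + 1) ∈ Top :=
  (h.memT _).2 ⟨2 * k + 1, ⟨k, rfl⟩, rfl⟩

lemma Anti.reach_step (h : Anti m V Bot Top W) (hT : IsTriangulation V T) (k : ℤ) :
    (mixGraph Bot Top T).Reachable ⟨W (2 * k + 1), h.topmem k⟩
      ⟨W (2 * (k + 1) + 1), h.topmem (k + 1)⟩ := by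
  by_contra hn
  set t : Top := ⟨W (2 * k + 1), h.topmem k⟩ with ht
  let P : Finset Pt3 := Top.filter (fun x => ∃ hx : x ∈ Top, (mixGraph Bot Top T).Reachable t ⟨x, hx⟩)
  obtain ⟨σ, hσ, h2, x, hx, y, hy, hyP, hxσ, hyσ⟩ := h.sperner hT (p := 2 * k + 2)
    ⟨k + 1, by ring⟩ (P := P) (Finset.filter_subset _ _)
    (by
      rw [show 2 * k + 2 - 1 = 2 * k + 1 by ring]
      exact Finset.mem_filter.2 ⟨h.topmem k, h.topmem k, SimpleGraph.Reachable.refl _⟩)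
    (by
      rw [show 2 * k + 2 + 1 = 2 * (k + 1) + 1 by ring]
      intro hm
      obtain ⟨-, hx, hr⟩ := Finset.mem_filter.1 hm
      exact hn hr)
  obtain ⟨-, hx', hr⟩ := Finset.mem_filter.1 hx
  apply hyP
  refine Finset.mem_filter.2 ⟨hy, hy, hr.trans (SimpleGraph.Adj.reachable ?_)⟩
  refine ⟨fun e => ?_, σ, hσ, h2, hxσ, hyσ⟩
  have e' : x = y := congrArg Subtype.val e
  exact hyP (e' ▸ hx)

lemma Anti.connected (h : Anti m V Bot Top W) (hT : IsTriangulation V T) :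
    (mixGraph Bot Top T).Connected := by
  have h1 : ∀ k : ℕ, (mixGraph Bot Top T).Reachable ⟨W (2 * 0 + 1), h.topmem 0⟩
      ⟨W (2 * (k : ℤ) + 1), h.topmem k⟩ := by
    intro k
    induction k with
    | zero => exact SimpleGraph.Reachable.refl _
    | succ k ih => exact_mod_cast ih.trans (h.reach_step hT k)
  have h2 : ∀ y : Top, (mixGraph Bot Top T).Reachable ⟨W (2 * 0 + 1), h.topmem 0⟩ y := by
    rintro ⟨y, hy⟩
    obtain ⟨p, ⟨k, rfl⟩, rfl⟩ := (h.memT _).1 hy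
    have hm := h.hm
    have hpos : (0:ℤ) < m := by omega
    have e : W (2 * k + 1) = W (2 * ((k % m).toNat : ℤ) + 1) := by
      rw [h.eq_iff, Int.toNat_of_nonneg (Int.emod_nonneg _ hpos.ne')]
      refine ⟨k / m, ?_⟩
      have := Int.emod_add_mul_ediv k m
      linear_combination (-2) * this
    have := h1 (k % m).toNat
    convert this using 2
  have : Nonempty Top := ⟨⟨_, h.topmem 0⟩⟩
  exact SimpleGraph.Connected.mk fun x y => (h2 x).symm.trans (h2 y)

theorem Anti.mixed (h : Anti m V Bot Top W) (hT : IsTriangulation V T) :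
    m - 1 ≤ (T.filter (fun σ => (σ ∩ Bot).card = 2 ∧ (σ ∩ Top).card = 2)).card := by
  have hc := (h.connected hT).card_vert_le_card_edgeSet_add_one
  rw [Nat.card_eq_fintype_card, Fintype.card_coe, h.cardT] at hc
  set M := T.filter (fun σ => (σ ∩ Bot).card = 2 ∧ (σ ∩ Top).card = 2) with hM
  have hch : ∀ e : (mixGraph Bot Top T).edgeSet, ∃ σ : M, ∀ x ∈ e.1, (x : Pt3) ∈ σ.1 := by
    rintro ⟨e, he⟩
    induction e using Sym2.ind with
    | _ x y =>
      obtain ⟨-, σ, hσ, h2, hx, hy⟩ := he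
      have hs := h.card_split (tri_sub hT hσ)
      rw [(tri_tet hT hσ).1] at hs
      refine ⟨⟨σ, Finset.mem_filter.2 ⟨hσ, h2, by omega⟩⟩, ?_⟩
      intro z hz
      rcases Sym2.mem_iff.1 hz with rfl | rfl <;> assumption
  choose g hg using hch
  have hinj : Function.Injective g := by
    rintro ⟨e, he⟩ ⟨e', he'⟩ hgg
    have h1 := hg ⟨e, he⟩
    have h2 := hg ⟨e', he'⟩
    rw [← hgg] at h2
    clear hgg
    generalize g ⟨e, he⟩ = s at h1 h2
    obtain ⟨σ, hσ⟩ := s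
    have hσ2 := (Finset.mem_filter.1 hσ).2.2
    have key : ∀ e ∈ (mixGraph Bot Top T).edgeSet, (∀ x ∈ e, (x : Pt3) ∈ σ) →
        ∀ z : Top, (z : Pt3) ∈ σ → z ∈ e := by
      intro e he hx z hz
      induction e using Sym2.ind with
      | _ x y =>
        have hxy : (x : Pt3) ≠ y := fun h => he.1 (Subtype.ext h)
        have hxσ := hx x (by simp)
        have hyσ := hx y (by simp)
        have : ({(x : Pt3), (y : Pt3)} : Finset Pt3) = σ ∩ Top := by
          apply Finset.eq_of_subset_of_card_le
          · intro p hp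
            simp only [Finset.mem_insert, Finset.mem_singleton] at hp
            rcases hp with rfl | rfl
            · exact Finset.mem_inter.2 ⟨hxσ, x.2⟩
            · exact Finset.mem_inter.2 ⟨hyσ, y.2⟩
          · rw [hσ2, Finset.card_pair hxy]
        have hz' : (z : Pt3) ∈ σ ∩ Top := Finset.mem_inter.2 ⟨hz, z.2⟩
        rw [← this] at hz'
        simp only [Finset.mem_insert, Finset.mem_singleton] at hz'
        rw [Sym2.mem_iff]
        rcases hz' with h | h
        · exact Or.inl (Subtype.ext h)
        · exact Or.inr (Subtype.ext h)
    apply Subtype.ext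
    apply Sym2.ext
    intro z
    exact ⟨fun hz => key e' he' h2 z (h1 z hz), fun hz => key e he h1 z (h2 z hz)⟩
  have := Nat.card_le_card_of_injective g hinj
  rw [Nat.card_eq_fintype_card (α := M), Fintype.card_coe] at this
  omega

end anti


lemma bump {K : Set Pt3} {x : Pt3} (hx : x ∈ interior K) (u : Pt3) :
    ∃ e : ℝ, 0 < e ∧ AffineMap.lineMap x u e ∈ K ∧ AffineMap.lineMap x u (-e) ∈ K := by
  have hc : Continuous (fun e : ℝ => (AffineMap.lineMap x u e : Pt3)) :=
    AffineMap.lineMap_continuous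
  have h0 : (fun e : ℝ => (AffineMap.lineMap x u e : Pt3)) ⁻¹' K ∈ nhds (0 : ℝ) := by
    apply hc.continuousAt.preimage_mem_nhds
    simpa using mem_interior_iff_mem_nhds.1 hx
  obtain ⟨r, hr, hb⟩ := Metric.mem_nhds_iff.1 h0
  refine ⟨r / 2, by positivity, ?_, ?_⟩
  · apply hb
    simp only [Metric.mem_ball, dist_zero_right, Real.norm_eq_abs]
    rw [abs_of_pos (by positivity)]; linarith
  · apply hb
    simp only [Metric.mem_ball, dist_zero_right, Real.norm_eq_abs]
    rw [abs_neg, abs_of_pos (by positivity)]; linarith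

lemma int_pos {V : Finset Pt3} {f : Aff3} (hf : ∀ v ∈ V, 0 ≤ f v) (hne : ∃ v ∈ V, f v ≠ 0)
    {x : Pt3} (hx : x ∈ interior (hull V)) : 0 < f x := by
  obtain ⟨v, hv, hfv⟩ := hne
  have hfv' : 0 < f v := lt_of_le_of_ne (hf v hv) (Ne.symm hfv)
  have h0 := hull_nonneg hf (interior_subset hx)
  obtain ⟨e, he, -, h2⟩ := bump hx v
  have h3 := hull_nonneg hf h2
  rw [aff_line] at h3
  by_contra hn
  have : f x = 0 := by linarith
  rw [this] at h3
  nlinarith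

lemma int_zero {S : Finset Pt3} {f : Aff3} (hf : ∀ v ∈ S, f v = 0)
    {x : Pt3} (hx : x ∈ interior (hull S)) (u : Pt3) : f u = 0 := by
  obtain ⟨e, he, h2, -⟩ := bump hx u
  have h3 := hull_zero hf h2
  rw [aff_line, hull_zero hf (interior_subset hx)] at h3
  have : e * f u = 0 := by linarith
  exact (mul_eq_zero.1 this).resolve_left he.ne'

lemma support {V : Finset Pt3} (hi : (interior (hull V)).Nonempty) {y : Pt3}
    (hy : y ∉ interior (hull V)) :
    ∃ g : Aff3, (∀ v ∈ V, 0 ≤ g v) ∧ (∃ v ∈ V, g v ≠ 0) ∧ g y ≤ 0 := by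
  have hcv : Convex ℝ (hull V) := convex_convexHull ℝ _
  obtain ⟨f, hf⟩ := geometric_hahn_banach_open_point hcv.interior isOpen_interior hy
  let g : Aff3 := AffineMap.const ℝ Pt3 (f y) - (f : Pt3 →ₗ[ℝ] ℝ).toAffineMap
  have hg : ∀ x, g x = f y - f x := fun x => rfl
  have hcl : ∀ x ∈ hull V, f x ≤ f y := by
    intro x hx
    have h1 : x ∈ closure (interior (hull V)) := by
      rw [hcv.closure_interior_eq_closure_of_nonempty_interior hi]
      exact subset_closure hx
    have h2 : closure (interior (hull V)) ⊆ {z | f z ≤ f y} :=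
      closure_minimal (fun z hz => (hf z hz).le) (isClosed_le f.continuous continuous_const)
    exact h2 h1
  refine ⟨g, fun v hv => ?_, ?_, by rw [hg]; simp⟩
  · rw [hg]; linarith [hcl v (mem_hull hv)]
  · by_contra hn
    push Not at hn
    obtain ⟨x, hx⟩ := hi
    have h1 := hull_zero hn (interior_subset hx)
    rw [hg] at h1
    linarith [hf x hx]

lemma tet_int {σ : Finset Pt3} (h : IsTet σ) : (interior (hull σ)).Nonempty := by
  rw [interior_convexHull_nonempty_iff_affineSpan_eq_top]
  have hspan : affineSpan ℝ (Set.range (fun p : (σ : Set Pt3) => (p : Pt3))) = ⊤ := by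
    rw [h.2.affineSpan_eq_top_iff_card_eq_finrank_add_one]
    simp [h.1]
  simpa using hspan

lemma cone_tet {V F : Finset Pt3} (hV : AllExt V) (hF : F ⊆ V) (h3 : F.card = 3) {v : Pt3}
    {f : Aff3} (h0 : ∀ w ∈ F, f w = 0) (hv : 0 < f v) : IsTet (insert v F) := by
  have hvF : v ∉ F := fun h => by have := h0 v h; linarith
  rw [tet_iff]
  refine ⟨by rw [Finset.card_insert_of_notMem hvF, h3], ?_⟩
  intro u hu
  rw [Finset.mem_insert] at hu
  by_cases huv : u = v
  · subst huv
    refine ⟨(f u)⁻¹ • f, ?_, ?_⟩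
    · simp [hv.ne']
    · intro w hw hne
      rw [Finset.mem_insert] at hw
      simp [h0 w (hw.resolve_left hne)]
  · have huF := hu.resolve_left huv
    obtain ⟨g, g1, g0⟩ := coords3 hV hF h3 u huF
    refine ⟨g - (g v / f v) • f, ?_, ?_⟩
    · simp [g1, h0 u huF]
    · intro w hw hne
      rw [Finset.mem_insert] at hw
      rcases hw with rfl | hw
      · simp [hv.ne']
      · simp [g0 w hw hne, h0 w hw]

lemma cone_rep {F : Finset Pt3} (hF : F.Nonempty) {v x : Pt3} (hx : x ∈ hull (insert v F)) :
    ∃ y ∈ hull F, ∃ a : ℝ, 0 ≤ a ∧ a ≤ 1 ∧ AffineMap.lineMap v y a = x := by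
  unfold hull at hx
  rw [Finset.coe_insert, convexHull_insert (by exact_mod_cast hF), mem_convexJoin] at hx
  obtain ⟨v', hv', y, hy, hxy⟩ := hx
  rw [Set.mem_singleton_iff] at hv'
  subst hv'
  rw [segment_eq_image_lineMap] at hxy
  obtain ⟨a, ⟨h0, h1⟩, h⟩ := hxy
  exact ⟨y, hy, a, h0, h1, h⟩

lemma cone_inter {V F F' : Finset Pt3} {v x : Pt3} {f f' : Aff3} (hF : F ⊆ V) (hF' : F' ⊆ V)
    (hn : F.Nonempty) (hn' : F'.Nonempty)
    (hf : ∀ w ∈ V, 0 ≤ f w) (h0 : ∀ w ∈ F, f w = 0) (hv : 0 < f v)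
    (hf' : ∀ w ∈ V, 0 ≤ f' w) (h0' : ∀ w ∈ F', f' w = 0) (hv' : 0 < f' v)
    (hi : ∀ y, y ∈ hull F → y ∈ hull F' → y ∈ hull (F ∩ F'))
    (hx : x ∈ hull (insert v F)) (hx' : x ∈ hull (insert v F')) :
    x ∈ hull (insert v F ∩ insert v F') := by
  obtain ⟨y, hy, a, a0, a1, rfl⟩ := cone_rep hn hx
  obtain ⟨y', hy', b, b0, b1, hb⟩ := cone_rep hn' hx'
  have e1 := congrArg f hb
  have e2 := congrArg f' hb
  rw [aff_line, aff_line, hull_zero h0 hy] at e1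
  rw [aff_line, aff_line, hull_zero h0' hy'] at e2
  have p1 := mul_nonneg b0 (hull_nonneg (fun w hw => hf w (hF' hw)) hy')
  have p2 := mul_nonneg a0 (hull_nonneg (fun w hw => hf' w (hF hw)) hy)
  have hab : a = b := by
    apply le_antisymm
    · by_contra hlt
      nlinarith
    · by_contra hlt
      nlinarith
  subst hab
  rw [← Finset.insert_inter_distrib]
  rcases a0.eq_or_lt with ha | ha
  · subst ha
    simp only [AffineMap.lineMap_apply_zero]
    exact mem_hull (by simp)
  · have hyy : y' = y := by
      simp only [AffineMap.lineMap_apply, vsub_eq_sub, vadd_eq_add, add_left_inj] at hb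
      have := smul_right_injective Pt3 ha.ne' hb
      simpa using this
    subst hyy
    exact hull_line (mem_hull (by simp)) (hull_mono (Finset.subset_insert _ _) (hi _ hy hy')) ha.le a1

lemma exit_point {V : Finset Pt3} {v x : Pt3} (hx : x ∈ interior (hull V)) (hne : v ≠ x) :
    ∃ s : ℝ, 1 ≤ s ∧ AffineMap.lineMap v x s ∈ hull V ∧
      AffineMap.lineMap v x s ∉ interior (hull V) := by
  let S : Set ℝ := {s | 1 ≤ s ∧ AffineMap.lineMap v x s ∈ hull V}
  have hc : Continuous (fun e : ℝ => (AffineMap.lineMap v x e : Pt3)) :=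
    AffineMap.lineMap_continuous
  have hcl : IsClosed S :=
    (isClosed_le continuous_const continuous_id).inter ((hull_compact V).isClosed.preimage hc)
  have h1 : (1 : ℝ) ∈ S := ⟨le_refl _, by simpa using interior_subset hx⟩
  obtain ⟨R, hR⟩ := (hull_compact V).isBounded.subset_closedBall v
  have hd : 0 < dist v x := dist_pos.2 hne
  have hbd : BddAbove S := by
    refine ⟨R / dist v x, ?_⟩
    rintro s ⟨hs1, hs⟩
    have := hR hs
    rw [Metric.mem_closedBall, dist_lineMap_left, Real.norm_eq_abs, abs_of_pos (by linarith)] at this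
    rwa [le_div_iff₀ hd]
  have hmax := hcl.csSup_mem ⟨1, h1⟩ hbd
  refine ⟨sSup S, hmax.1, hmax.2, ?_⟩
  intro hi
  obtain ⟨e, he, -, hm⟩ := bump hi v
  have : sSup S + e * sSup S ∈ S := by
    have hp : 0 ≤ e * sSup S := mul_nonneg he.le (by linarith [hmax.1])
    refine ⟨by linarith [hmax.1], ?_⟩
    convert hm using 1
    simp only [AffineMap.lineMap_apply, vsub_eq_sub, vadd_eq_add]
    module
  have h2 := le_csSup hbd this
  have : 0 < e * sSup S := mul_pos he (by linarith [hmax.1])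
  linarith

theorem cone_triangulation {V : Finset Pt3} (hV : AllExt V) (hi : (interior (hull V)).Nonempty)
    {v : Pt3} (hvV : v ∈ V) {C : Finset (Finset Pt3)} (hne : C.Nonempty)
    (h1 : ∀ F ∈ C, F ⊆ V ∧ F.card = 3 ∧
      ∃ f : Aff3, (∀ w ∈ V, 0 ≤ f w) ∧ (∀ w ∈ F, f w = 0) ∧ 0 < f v)
    (h2 : ∀ F ∈ C, ∀ F' ∈ C, ∀ y, y ∈ hull F → y ∈ hull F' → y ∈ hull (F ∩ F'))
    (h3 : ∀ y ∈ hull V, ∀ g : Aff3, (∀ w ∈ V, 0 ≤ g w) → (∃ w ∈ V, g w ≠ 0) → g y = 0 →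
      (∃ F ∈ C, y ∈ hull F) ∨
        ∃ f : Aff3, (∀ w ∈ V, 0 ≤ f w) ∧ (∃ w ∈ V, f w ≠ 0) ∧ f v = 0 ∧ f y = 0) :
    IsTriangulation V (C.image (insert v)) ∧ (C.image (insert v)).card = C.card := by
  have hff : ∀ F ∈ C, ∀ F' ∈ C, ∀ x, x ∈ hull (insert v F) → x ∈ hull (insert v F') →
      x ∈ hull (insert v F ∩ insert v F') := by
    intro F hF F' hF' x hx hx'
    obtain ⟨hs, hc, f, f1, f2, f3⟩ := h1 F hF
    obtain ⟨hs', hc', f', f1', f2', f3'⟩ := h1 F' hF'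
    exact cone_inter hs hs' (Finset.card_pos.1 (by omega)) (Finset.card_pos.1 (by omega))
      f1 f2 f3 f1' f2' f3' (h2 F hF F' hF') hx hx'
  have htet : ∀ F ∈ C, IsTet (insert v F) := by
    intro F hF
    obtain ⟨hs, hc, f, f1, f2, f3⟩ := h1 F hF
    exact cone_tet hV hs hc f2 f3
  have hnot : ∀ F ∈ C, v ∉ F := by
    intro F hF hv
    obtain ⟨hs, hc, f, f1, f2, f3⟩ := h1 F hF
    have := f2 v hv
    linarith
  refine ⟨⟨⟨?_, ?_, ?_⟩, ?_⟩, ?_⟩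
  · intro σ hσ
    obtain ⟨F, hF, rfl⟩ := Finset.mem_image.1 hσ
    refine ⟨htet F hF, ?_⟩
    exact_mod_cast Finset.insert_subset hvV (h1 F hF).1
  · intro σ hσ τ hτ hst
    obtain ⟨F, hF, rfl⟩ := Finset.mem_image.1 hσ
    obtain ⟨F', hF', rfl⟩ := Finset.mem_image.1 hτ
    rw [Set.eq_empty_iff_forall_notMem]
    intro x hx
    rw [← interior_inter] at hx
    have hx' : x ∈ interior (hull (insert v F ∩ insert v F')) :=
      interior_mono (fun z hz => hff F hF F' hF' z hz.1 hz.2) hx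
    have : ∃ u ∈ insert v F, u ∉ insert v F' := by
      by_contra hn
      push Not at hn
      exact hst (Finset.eq_of_subset_of_card_le hn (by rw [(htet F hF).1, (htet F' hF').1]))
    obtain ⟨u, hu, hu'⟩ := this
    obtain ⟨f, f1, f0⟩ := (tet_iff.1 (htet F hF)).2 u hu
    have := int_zero (f := f) (fun w hw => f0 w (Finset.mem_inter.1 hw).1
      (fun h => hu' (h ▸ (Finset.mem_inter.1 hw).2))) hx' u
    rw [f1] at this
    exact one_ne_zero this
  · apply Set.Subset.antisymm
    · apply Set.iUnion₂_subset
      intro σ hσ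
      obtain ⟨F, hF, rfl⟩ := Finset.mem_image.1 hσ
      exact hull_mono (Finset.insert_subset hvV (h1 F hF).1)
    · have hcl : IsClosed (⋃ σ ∈ C.image (insert v), convexHull ℝ (σ : Set Pt3)) :=
        Set.Finite.isClosed_biUnion (C.image (insert v)).finite_toSet
          (fun σ _ => (hull_compact σ).isClosed)
      have hsub : interior (hull V) ⊆ ⋃ σ ∈ C.image (insert v), convexHull ℝ (σ : Set Pt3) := by
        intro x hx
        suffices ∃ F ∈ C, x ∈ hull (insert v F) by
          obtain ⟨F, hF, h⟩ := this
          exact Set.mem_biUnion (Finset.mem_coe.2 (Finset.mem_image_of_mem _ hF)) h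
        by_cases hvx : v = x
        · obtain ⟨F, hF⟩ := hne
          exact ⟨F, hF, mem_hull (by simp [hvx])⟩
        obtain ⟨s, hs, hsV, hsi⟩ := exit_point hx hvx
        obtain ⟨g, g1, g2, g3⟩ := support hi hsi
        have hs0 : s ≠ 0 := by linarith
        have hxs : x = AffineMap.lineMap v (AffineMap.lineMap v x s) (s⁻¹) := by
          simp only [AffineMap.lineMap_apply, vsub_eq_sub, vadd_eq_add, add_sub_cancel_right, smul_smul]
          rw [inv_mul_cancel₀ hs0]; simp
        have hsi0 : 0 ≤ s⁻¹ := by positivity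
        have hsi1 : s⁻¹ ≤ 1 := inv_le_one_of_one_le₀ hs
        rcases h3 _ hsV g g1 g2 (le_antisymm g3 (hull_nonneg g1 hsV)) with ⟨F, hF, hy⟩ | ⟨f, f1, f2, f3, f4⟩
        · refine ⟨F, hF, ?_⟩
          rw [hxs]
          exact hull_line (mem_hull (by simp)) (hull_mono (Finset.subset_insert _ _) hy) hsi0 hsi1
        · exfalso
          have := int_pos f1 f2 hx
          rw [hxs, aff_line, f3, f4] at this
          simp at this
      have hcv : Convex ℝ (hull V) := convex_convexHull ℝ _
      calc hull V ⊆ closure (hull V) := subset_closure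
        _ = closure (interior (hull V)) :=
          (hcv.closure_interior_eq_closure_of_nonempty_interior hi).symm
        _ ⊆ _ := closure_minimal hsub hcl
  · intro σ hσ τ hτ
    obtain ⟨F, hF, rfl⟩ := Finset.mem_image.1 hσ
    obtain ⟨F', hF', rfl⟩ := Finset.mem_image.1 hτ
    apply Set.Subset.antisymm
    · intro z hz
      exact hff F hF F' hF' z hz.1 hz.2
    · exact Set.subset_inter (hull_mono Finset.inter_subset_left) (hull_mono Finset.inter_subset_right)
  · apply Finset.card_image_of_injOn
    intro F hF F' hF' he
    have h := congrArg (fun s => Finset.erase s v) he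
    simpa [Finset.erase_insert (hnot F hF), Finset.erase_insert (hnot F' hF')] using h


lemma generic (B : Finset Pt3) (hB : B.Nonempty) (L : Finset Aff3)
    (hL : ∀ l ∈ L, ∃ v ∈ B, l v ≠ 0) : ∃ p ∈ hull B, ∀ l ∈ L, l p ≠ 0 := by
  induction L using Finset.induction_on with
  | empty =>
    obtain ⟨b, hb⟩ := hB
    exact ⟨b, mem_hull hb, by simp⟩
  | insert l L _ ih =>
    obtain ⟨p, hp, hpL⟩ := ih (fun l hl => hL l (Finset.mem_insert_of_mem hl))
    obtain ⟨v, hv, hlv⟩ := hL l (Finset.mem_insert_self _ _)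
    by_cases h0 : l p = 0
    · have hc : ∀ l' : Aff3, Continuous (fun e : ℝ => l' (AffineMap.lineMap p v e)) := fun l' =>
        (aff_cont l').comp AffineMap.lineMap_continuous
      have h1 : ∀ᶠ e in nhdsWithin (0:ℝ) (Set.Ioi 0), ∀ l' ∈ L,
          l' (AffineMap.lineMap p v e) ≠ 0 := by
        rw [Filter.eventually_all_finset]
        intro l' hl'
        apply Filter.Eventually.filter_mono nhdsWithin_le_nhds
        apply (hc l').continuousAt.eventually_ne
        simpa using hpL l' hl'
      have h2 : ∀ᶠ e in nhdsWithin (0:ℝ) (Set.Ioi 0), e ∈ Set.Ioo (0:ℝ) 1 :=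
        Ioo_mem_nhdsGT one_pos
      obtain ⟨e, he1, he2, he3⟩ := (h1.and h2).exists
      refine ⟨_, hull_line hp (mem_hull hv) he2.le he3.le, ?_⟩
      intro l' hl'
      rw [Finset.mem_insert] at hl'
      rcases hl' with rfl | hl'
      · rw [aff_line, h0]
        simp [he2.ne', hlv]
      · exact he1 l' hl'
    · refine ⟨p, hp, ?_⟩
      intro l' hl'
      rw [Finset.mem_insert] at hl'
      rcases hl' with rfl | hl'
      · exact h0
      · exact hpL l' hl'

lemma face_cover {V B : Finset Pt3} {T : Finset (Finset Pt3)} {f : Aff3}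
    (hT : IsTriangulation V T) (hV : AllExt V) (hB : FaceOf V B f) (h3 : 3 ≤ B.card) {y : Pt3}
    (hy : y ∈ hull B) : ∃ σ ∈ T, (σ ∩ B).card = 3 ∧ y ∈ hull (σ ∩ B) := by
  have hex : ∀ S : Finset Pt3, ∃ l : Aff3, S ⊆ B → S.card ≤ 2 →
      (∀ v ∈ S, l v = 0) ∧ ∃ v ∈ B, l v ≠ 0 := by
    intro S
    by_cases hS : S ⊆ B ∧ S.card ≤ 2
    · obtain ⟨F, hSF, hFB, hF⟩ := Finset.exists_subsuperset_card_eq hS.1 (by omega : S.card ≤ 3) h3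
      obtain ⟨u, huF, huS⟩ := Finset.exists_mem_notMem_of_card_lt_card (by omega : S.card < F.card)
      obtain ⟨l, l1, l0⟩ := coords3 hV (hFB.trans hB.sub) hF u huF
      exact ⟨l, fun _ _ => ⟨fun v hv => l0 v (hSF hv) (fun h => huS (h ▸ hv)), u, hFB huF, by
        rw [l1]; exact one_ne_zero⟩⟩
    · exact ⟨0, fun h1 h2 => absurd ⟨h1, h2⟩ hS⟩
  choose l hl using hex
  let L := (T.filter (fun σ => (σ ∩ B).card ≤ 2)).image (fun σ => l (σ ∩ B))
  obtain ⟨p, hp, hpL⟩ := generic B (Finset.card_pos.1 (by omega)) L (by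
    intro k hk
    obtain ⟨σ, hσ, rfl⟩ := Finset.mem_image.1 hk
    exact (hl (σ ∩ B) Finset.inter_subset_right (Finset.mem_filter.1 hσ).2).2)
  obtain ⟨σ, hσ, hyσ, e, he0, he1, heσ⟩ := near hT (hull_mono hB.sub hy) (hull_mono hB.sub hp)
  have m1 := hB.mem_inter (tri_sub hT hσ) hyσ (hB.zero hy)
  have m2 := hB.mem_inter (tri_sub hT hσ) heσ (hB.zero (hull_line hy hp he0.le he1.le))
  refine ⟨σ, hσ, ?_, m1⟩
  by_contra hn
  have hle := hB.card_le hT hσ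
  have h2 : (σ ∩ B).card ≤ 2 := by omega
  have hz := (hl (σ ∩ B) Finset.inter_subset_right h2).1
  have e1 := hull_zero hz m1
  have e2 := hull_zero hz m2
  rw [aff_line, e1] at e2
  have e3 : e * (l (σ ∩ B)) p = 0 := by linarith
  exact hpL _ (Finset.mem_image_of_mem (fun σ => l (σ ∩ B)) (Finset.mem_filter.2 ⟨hσ, h2⟩))
    ((mul_eq_zero.1 e3).resolve_left he0.ne')

section anti
variable {m : ℕ} {V Bot Top : Finset Pt3} {W : ℤ → Pt3} {T : Finset (Finset Pt3)}

lemma Anti.int_ne (h : Anti m V Bot Top W) (hT : IsTriangulation V T) :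
    (interior (hull V)).Nonempty := by
  have h0 := mem_hull (h.W_mem 0)
  obtain ⟨σ, hσ, -⟩ := near hT h0 h0
  exact (tet_int (tri_tet hT hσ)).mono (interior_mono (hull_mono (tri_sub hT hσ)))

/-- Reduction of a band triangle to a standard index. -/
lemma Anti.band_index (h : Anti m V Bot Top W) (p : ℤ) : ∃ q : ℤ, 0 ≤ q ∧ q < 2 * m ∧
    ∀ i : ℤ, W (q + i) = W (p + i) := by
  have hm := h.hm
  refine ⟨p % (2 * m), Int.emod_nonneg _ (by omega), Int.emod_lt_of_pos _ (by omega), ?_⟩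
  intro i
  rw [h.eq_iff]
  refine ⟨-(p / (2 * m)), ?_⟩
  have := Int.emod_add_mul_ediv p (2 * m)
  linarith

lemma Anti.notMem_band (h : Anti m V Bot Top W) {p : ℤ} (h2 : 2 ≤ p) (h3 : p ≤ 2 * m - 2) :
    W 1 ∉ ({W p, W (p + 1), W (p + 2)} : Finset Pt3) := by
  have key : ∀ q : ℤ, 2 ≤ q → q ≤ 2 * m → W 1 ≠ W q := by
    intro q hq1 hq2 he
    have := Int.eq_zero_of_abs_lt_dvd ((h.eq_iff q 1).1 he.symm) (by rw [abs_lt]; omega)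
    omega
  simp only [Finset.mem_insert, Finset.mem_singleton, not_or]
  exact ⟨key _ h2 (by omega), key _ (by omega) (by omega), key _ (by omega) (by omega)⟩

lemma Anti.band_inj (h : Anti m V Bot Top W) {p q : ℤ} (hp : 2 ≤ p) (hp' : p ≤ 2 * m - 2)
    (hq : 2 ≤ q) (hq' : q ≤ 2 * m - 2)
    (he : ({W p, W (p + 1), W (p + 2)} : Finset Pt3) = {W q, W (q + 1), W (q + 2)}) : p = q := by
  have key : ∀ a b : ℤ, 2 ≤ a → a ≤ 2 * m → 2 ≤ b → b ≤ 2 * m → W a = W b → a = b := by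
    intro a b h1 h2 h3 h4 he
    have := Int.eq_zero_of_abs_lt_dvd ((h.eq_iff a b).1 he) (by rw [abs_lt]; omega)
    omega
  have h1 : W p ∈ ({W q, W (q + 1), W (q + 2)} : Finset Pt3) := by rw [← he]; simp
  have h2 : W q ∈ ({W p, W (p + 1), W (p + 2)} : Finset Pt3) := by rw [he]; simp
  simp only [Finset.mem_insert, Finset.mem_singleton] at h1 h2
  have i1 : q ≤ p := by
    rcases h1 with h1 | h1 | h1 <;> have := key _ _ (by omega) (by omega) (by omega) (by omega) h1 <;> omega
  have i2 : p ≤ q := by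
    rcases h2 with h2 | h2 | h2 <;> have := key _ _ (by omega) (by omega) (by omega) (by omega) h2 <;> omega
  omega

lemma Anti.mix_band (h : Anti m V Bot Top W) (p : ℤ) :
    ¬ ({W p, W (p + 1), W (p + 2)} : Finset Pt3) ⊆ Bot := by
  intro hs
  rcases Int.even_or_odd p with hp | hp
  · exact h.disj (hs (by simp : W (p + 1) ∈ _)) ((h.memT _).2 ⟨p + 1, hp.add_one, rfl⟩)
  · exact h.disj (hs (by simp : W p ∈ _)) ((h.memT _).2 ⟨p, hp, rfl⟩)

theorem Anti.coning (h : Anti m V Bot Top W) (hT : IsTriangulation V T) :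
    ∃ T', IsTriangulation V T' ∧ T'.card = 3 * m - 5 ∧ ∃ v ∈ Top, ∀ σ ∈ T', v ∈ σ := by
  have hm := h.hm
  have hV := h.ext
  obtain ⟨fb, hfb⟩ := h.bot
  have hW1T : W 1 ∈ Top := (h.memT _).2 ⟨1, odd_one, rfl⟩
  have hW1B : W 1 ∉ Bot := fun hb => h.disj hb hW1T
  let C1 : Finset (Finset Pt3) :=
    (Finset.Icc (2:ℤ) (2 * m - 2)).image (fun p => {W p, W (p + 1), W (p + 2)})
  let C2 : Finset (Finset Pt3) := (T.filter (fun σ => (σ ∩ Bot).card = 3)).image (fun σ => σ ∩ Bot)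
  have hC1 : ∀ F ∈ C1, ∃ p : ℤ, 2 ≤ p ∧ p ≤ 2 * m - 2 ∧ F = {W p, W (p + 1), W (p + 2)} := by
    intro F hF
    obtain ⟨p, hp, rfl⟩ := Finset.mem_image.1 hF
    rw [Finset.mem_Icc] at hp
    exact ⟨p, hp.1, hp.2, rfl⟩
  have hC2 : ∀ F ∈ C2, ∃ σ ∈ T, (σ ∩ Bot).card = 3 ∧ F = σ ∩ Bot := by
    intro F hF
    obtain ⟨σ, hσ, rfl⟩ := Finset.mem_image.1 hF
    rw [Finset.mem_filter] at hσ
    exact ⟨σ, hσ.1, hσ.2, rfl⟩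
  have c1 : C1.card = 2 * m - 3 := by
    rw [Finset.card_image_of_injOn, Int.card_Icc]
    · omega
    · intro p hp q hq he
      rw [Finset.mem_coe, Finset.mem_Icc] at hp hq
      exact h.band_inj hp.1 hp.2 hq.1 hq.2 he
  have c2 : C2.card = m - 2 := by
    rw [Finset.card_image_of_injOn, face_count hT hV hfb (by rw [h.cardB]; omega), h.cardB]
    intro σ hσ τ hτ he
    rw [Finset.mem_coe, Finset.mem_filter] at hσ hτ
    have he' : σ ∩ Bot = τ ∩ Bot := he
    exact hfb.same hT hσ.1 hτ.1 hσ.2 Finset.inter_subset_right Finset.inter_subset_left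
      (by rw [he']; exact Finset.inter_subset_left)
  have hdis : Disjoint C1 C2 := by
    rw [Finset.disjoint_left]
    intro F h1 h2
    obtain ⟨p, -, -, rfl⟩ := hC1 F h1
    obtain ⟨σ, -, -, hF⟩ := hC2 _ h2
    exact h.mix_band p (by rw [hF]; exact Finset.inter_subset_right)
  have pos : ∀ {S : Finset Pt3} {f : Aff3}, FaceOf V S f → W 1 ∉ S → 0 < f (W 1) := by
    intro S f hf hn
    have h1 := hf.nn _ (h.W_mem 1)
    have h2 := hf.iff _ (h.W_mem 1)
    exact lt_of_le_of_ne h1 (fun h => hn (h2.1 h.symm))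
  have hW : ∀ p, ({W p, W (p + 1), W (p + 2)} : Finset Pt3) ⊆ V := by
    intro p x hx
    simp only [Finset.mem_insert, Finset.mem_singleton] at hx
    rcases hx with rfl | rfl | rfl <;> exact h.W_mem _
  suffices K : IsTriangulation V ((C1 ∪ C2).image (insert (W 1))) ∧
      ((C1 ∪ C2).image (insert (W 1))).card = (C1 ∪ C2).card by
    obtain ⟨k1, k2⟩ := K
    refine ⟨_, k1, ?_, W 1, hW1T, ?_⟩
    · rw [k2, Finset.card_union_of_disjoint hdis]; omega
    · intro σ hσ
      obtain ⟨F, -, rfl⟩ := Finset.mem_image.1 hσ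
      simp
  refine cone_triangulation hV (h.int_ne hT) (h.W_mem 1) (C := C1 ∪ C2)
    (Finset.card_pos.1 (by rw [Finset.card_union_of_disjoint hdis]; omega)) ?_ ?_ ?_
  · intro F hF
    rcases Finset.mem_union.1 hF with hF | hF
    · obtain ⟨p, hp, hp', rfl⟩ := hC1 F hF
      obtain ⟨f, hf⟩ := h.tri p
      exact ⟨hW p, h.tri_card p, f, hf.nn, fun w hw => (hf.iff w (hf.sub hw)).2 hw,
        pos hf (h.notMem_band hp hp')⟩
    · obtain ⟨σ, hσ, h3, rfl⟩ := hC2 F hF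
      exact ⟨Finset.inter_subset_left.trans (tri_sub hT hσ), h3, fb, hfb.nn,
        fun w hw => (hfb.iff w (hfb.sub (Finset.mem_inter.1 hw).2)).2 (Finset.mem_inter.1 hw).2,
        pos hfb hW1B⟩
  · have hsub : ∀ F ∈ C1 ∪ C2, F ⊆ V := by
      intro F hF
      rcases Finset.mem_union.1 hF with hF | hF
      · obtain ⟨p, hp, hp', rfl⟩ := hC1 F hF
        exact hW p
      · obtain ⟨σ, hσ, h3, rfl⟩ := hC2 F hF
        exact Finset.inter_subset_left.trans (tri_sub hT hσ)
    intro F hF F' hF' y hy hy'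
    rcases Finset.mem_union.1 hF with hF1 | hF1
    · obtain ⟨p, hp, hp', rfl⟩ := hC1 F hF1
      obtain ⟨f, hf⟩ := h.tri p
      rw [Finset.inter_comm]
      exact hf.mem_inter (hsub F' hF') hy' (hf.zero hy)
    · rcases Finset.mem_union.1 hF' with hF2 | hF2
      · obtain ⟨p, hp, hp', rfl⟩ := hC1 F' hF2
        obtain ⟨f, hf⟩ := h.tri p
        exact hf.mem_inter (hsub F hF) hy (hf.zero hy')
      · obtain ⟨σ, hσ, h3, rfl⟩ := hC2 F hF1
        obtain ⟨τ, hτ, h3', rfl⟩ := hC2 F' hF2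
        have h1 := tri_inter hT hσ hτ (hull_mono Finset.inter_subset_left hy)
          (hull_mono Finset.inter_subset_left hy')
        have h2 := hfb.mem_inter (Finset.inter_subset_left.trans (tri_sub hT hσ)) h1
          (hfb.zero (hull_mono Finset.inter_subset_right hy))
        refine hull_mono ?_ h2
        intro z hz
        simp only [Finset.mem_inter] at hz ⊢
        tauto
  · intro y hy g g1 g2 g3
    obtain ⟨S, hS, hzS⟩ := h.complete g g1 g2
    have hyS : y ∈ hull S := by
      refine hull_mono ?_ (face_mem g1 hy g3)
      intro z hz
      rw [Finset.mem_filter] at hz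
      exact hzS z hz.1 hz.2
    rcases hS with rfl | rfl | ⟨p, rfl⟩
    · left
      obtain ⟨σ, hσ, h3, hyσ⟩ := face_cover hT hV hfb (by rw [h.cardB]; omega) hyS
      exact ⟨_, Finset.mem_union_right _
        (Finset.mem_image_of_mem (fun σ => σ ∩ S) (Finset.mem_filter.2 ⟨hσ, h3⟩)), hyσ⟩
    · right
      obtain ⟨ft, hft⟩ := h.top
      exact ⟨ft, hft.nn, hft.ne, hft.zero (mem_hull hW1T), hft.zero hyS⟩
    · obtain ⟨q, hq0, hq1, hq⟩ := h.band_index p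
      have e0 := hq 0
      simp only [add_zero] at e0
      rw [← e0, ← hq, ← hq] at hyS
      by_cases hr : 2 ≤ q ∧ q ≤ 2 * m - 2
      · left
        refine ⟨_, Finset.mem_union_left _ (Finset.mem_image_of_mem _ (Finset.mem_Icc.2 hr)), hyS⟩
      · right
        obtain ⟨f, hf⟩ := h.tri q
        refine ⟨f, hf.nn, hf.ne, (hf.iff _ (h.W_mem 1)).2 ?_, hf.zero hyS⟩
        have : q = 0 ∨ q = 1 ∨ q = 2 * m - 1 := by omega
        simp only [Finset.mem_insert, Finset.mem_singleton]
        rcases this with rfl | rfl | rfl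
        · right; left; norm_num
        · left; rfl
        · right; right
          rw [h.eq_iff]
          exact ⟨-1, by ring⟩

end anti


lemma extreme_of_face {A : Finset Pt3} {f : Aff3} (hf : ∀ v ∈ A, 0 ≤ f v) :
    IsExtreme ℝ (hull A) (hull (A.filter (fun v => f v = 0))) := by
  refine ⟨hull_mono (Finset.filter_subset _ _), ?_⟩
  intro x hx y hy z hz hzo
  rw [openSegment_eq_image_lineMap] at hzo
  obtain ⟨e, ⟨h0, h1⟩, rfl⟩ := hzo
  have hz0 : f (AffineMap.lineMap x y e) = 0 :=
    hull_zero (fun v hv => (Finset.mem_filter.1 hv).2) hz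
  rw [aff_line] at hz0
  have fx := hull_nonneg hf hx
  have fy := hull_nonneg hf hy
  apply face_mem hf hx
  have : (1 - e) * f x = 0 := by nlinarith [mul_nonneg h0.le fy, mul_nonneg (by linarith : 0 ≤ 1 - e) fx]
  exact (mul_eq_zero.1 this).resolve_left (by linarith)

/-- If `c` is on an extreme set and can be pushed a bit away from `x`, then `x` is on the set. -/
lemma extreme_push {K L : Set Pt3} (h : IsExtreme ℝ K L) {c x : Pt3} (hx : x ∈ K) (hc : c ∈ L)
    {e : ℝ} (he : 0 < e) (hy : AffineMap.lineMap c x (-e) ∈ K) : x ∈ L := by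
  refine h.2 hx hy hc ?_
  rw [openSegment_eq_image_lineMap]
  refine ⟨1 / (1 + e), ⟨by positivity, ?_⟩, ?_⟩
  · rw [div_lt_one (by positivity)]; linarith
  · have h1 : (1 + e) ≠ 0 := by positivity
    ext i
    simp only [AffineMap.lineMap_apply, vsub_eq_sub, vadd_eq_add, Pi.add_apply, Pi.smul_apply,
      Pi.sub_apply, smul_eq_mul]
    field_simp
    ring

lemma face_of_extreme {V S : Finset Pt3} (hV : AllExt V) (hi : (interior (hull V)).Nonempty)
    (hS : S ⊆ V) (hne : S ≠ V) (h3 : 3 ≤ S.card) (hE : IsExtreme ℝ (hull V) (hull S)) :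
    ∃ f, FaceOf V S f := by
  have hSn : S.Nonempty := Finset.card_pos.1 (by omega)
  have hc : cen S ∈ hull S := cen_mem hSn
  have hci : cen S ∉ interior (hull V) := by
    intro hin
    apply hne
    apply Finset.Subset.antisymm hS
    intro v hv
    obtain ⟨e, he, -, hm⟩ := bump hin v
    exact ext_mem hV hS hv (extreme_push hE (mem_hull hv) hc he hm)
  obtain ⟨g, g1, ⟨w, hw, gw⟩, g3⟩ := support hi hci
  have gw' : 0 < g w := lt_of_le_of_ne (g1 w hw) (Ne.symm gw)
  have hsum : ∑ y ∈ S, g y = 0 := by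
    rw [cen_aff hSn] at g3
    have hp : (0:ℝ) < (S.card : ℝ)⁻¹ := by
      have : (0:ℝ) < S.card := by exact_mod_cast Finset.card_pos.2 hSn
      positivity
    have h0 := Finset.sum_nonneg (fun y hy => g1 y (hS hy))
    nlinarith
  have gS : ∀ y ∈ S, g y = 0 := (Finset.sum_eq_zero_iff_of_nonneg (fun y hy => g1 y (hS hy))).1 hsum
  refine ⟨g, hS, g1, fun x hx => ⟨fun hgx => ?_, gS x⟩, w, hw, gw⟩
  obtain ⟨F, hFS, hF3⟩ := Finset.exists_subset_card_eq h3
  have hFn : F.Nonempty := Finset.card_pos.1 (by omega)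
  have htet : IsTet (insert w F) := cone_tet hV (hFS.trans hS) hF3 (fun y hy => gS y (hFS hy)) gw'
  have hwF : w ∉ F := fun h => gw (gS w (hFS h))
  obtain ⟨c, c1, c2, c3, c4⟩ := tet_bary htet
  have hcF : ∀ u ∈ F, 0 < c u (cen F) := by
    intro u hu
    rw [cen_aff hFn, Finset.sum_eq_single_of_mem u hu
      (fun v hv hvu => c2 u (Finset.mem_insert_of_mem hu) v (Finset.mem_insert_of_mem hv) hvu),
      c1 u (Finset.mem_insert_of_mem hu), hF3]
    norm_num
  have hcw : ∀ z, g z = 0 → c w z = 0 := by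
    intro z hz
    have := c4 g z
    rw [Finset.sum_insert hwF, Finset.sum_eq_zero (fun u hu => by rw [gS u (hFS hu), mul_zero]), hz,
      add_zero] at this
    exact (mul_eq_zero.1 this.symm).resolve_right gw
  have hcc : ∀ l' : Aff3, Continuous (fun e : ℝ => l' (AffineMap.lineMap (cen F) x (-e))) := fun l' =>
    (aff_cont l').comp (AffineMap.lineMap_continuous.comp continuous_neg)
  have h1 : ∀ᶠ e in nhdsWithin (0:ℝ) (Set.Ioi 0), ∀ u ∈ F,
      0 < c u (AffineMap.lineMap (cen F) x (-e)) := by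
    rw [Filter.eventually_all_finset]
    intro u hu
    apply Filter.Eventually.filter_mono nhdsWithin_le_nhds
    apply (hcc (c u)).continuousAt.eventually_const_lt
    simpa using hcF u hu
  obtain ⟨e, he1, he2⟩ := (h1.and self_mem_nhdsWithin).exists
  have gc : g (cen F) = 0 := hull_zero (fun y hy => gS y (hFS hy)) (cen_mem hFn)
  refine ext_mem hV hS hx (extreme_push hE (mem_hull hx) (hull_mono hFS (cen_mem hFn)) he2 ?_)
  refine hull_mono (Finset.insert_subset hw (hFS.trans hS)) (c3 _ ?_)
  intro u hu
  rcases Finset.mem_insert.1 hu with rfl | hu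
  · rw [hcw]
    rw [aff_line, gc, hgx]; ring
  · exact (he1 u hu).le


/-- The angle of the `p`-th vertex of the standard antiprism. -/
def ang (m : ℕ) (p : ℤ) : ℝ := Real.pi * p / m

/-- The parity of `p` as a real number. -/
def par (p : ℤ) : ℝ := if Even p then 0 else 1

/-- The `p`-th vertex of the standard antiprism. -/
def SA (m : ℕ) (p : ℤ) : Pt3 := ![Real.cos (ang m p), Real.sin (ang m p), par p]

/-- The affine functional with given coefficients. -/
def lin3 (a b c d : ℝ) : Aff3 :=
  (a • LinearMap.proj (R := ℝ) (φ := fun _ : Fin 3 => ℝ) 0 + b • LinearMap.proj 1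
    + c • LinearMap.proj 2 : Pt3 →ₗ[ℝ] ℝ).toAffineMap + AffineMap.const ℝ Pt3 d

lemma lin3_apply (a b c d : ℝ) (x : Pt3) : lin3 a b c d x = a * x 0 + b * x 1 + c * x 2 + d := by
  simp [lin3]

lemma par_even {p : ℤ} (h : Even p) : par p = 0 := by simp [par, h]

lemma par_odd {p : ℤ} (h : Odd p) : par p = 1 := by
  have : ¬ Even p := by simpa using h
  simp [par, this]

section std
variable {m : ℕ}

lemma ang_sub (p q : ℤ) : ang m q - ang m p = ang m (q - p) := by
  unfold ang; push_cast; ring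

lemma cos_ang_one (hm : 0 < m) {k : ℤ} : Real.cos (ang m k) = 1 ↔ (2 * m : ℤ) ∣ k := by
  have hm' : (m : ℝ) ≠ 0 := by positivity
  rw [Real.cos_eq_one_iff]
  constructor
  · rintro ⟨n, hn⟩
    refine ⟨n, ?_⟩
    unfold ang at hn
    field_simp at hn
    have h2 : (k : ℝ) = ((2 * m * n : ℤ) : ℝ) := by
      push_cast; linarith
    exact_mod_cast h2
  · rintro ⟨n, rfl⟩
    refine ⟨n, ?_⟩
    unfold ang
    push_cast
    field_simp

lemma SA_eq (hm : 0 < m) {p q : ℤ} : SA m p = SA m q ↔ (2 * m : ℤ) ∣ p - q := by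
  constructor
  · intro h
    have h0 := congrFun h 0
    have h1 := congrFun h 1
    simp only [SA, Matrix.cons_val_zero, Matrix.cons_val_one] at h0 h1
    rw [← cos_ang_one hm, ← ang_sub, Real.cos_sub, h0, h1]
    nlinarith [Real.sin_sq_add_cos_sq (ang m q)]
  · rintro ⟨n, hn⟩
    have hp : p = q + 2 * (m * n) := by linarith
    have hm' : (m : ℝ) ≠ 0 := by positivity
    have ha : ang m p = ang m q + n * (2 * Real.pi) := by
      unfold ang; rw [hp]; push_cast; field_simp
    have hpar : par p = par q := by
      unfold par
      have : Even p ↔ Even q := by rw [hp]; simp [Int.even_add]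
      simp [this]
    unfold SA
    rw [ha, hpar, Real.cos_add_int_mul_two_pi, Real.sin_add_int_mul_two_pi]

lemma exists_rep (hm : 0 < m) (k : ℤ) : ∃ r : ℤ, -m < r ∧ r ≤ m ∧ (2 * m : ℤ) ∣ k - r := by
  have h1 := Int.emod_nonneg k (by omega : (2 * m : ℤ) ≠ 0)
  have h2 := Int.emod_lt_of_pos k (by omega : (0:ℤ) < 2 * m)
  have h3 := Int.emod_add_mul_ediv k (2 * m)
  by_cases h : k % (2 * m) ≤ m
  · exact ⟨k % (2 * m), by omega, h, k / (2 * m), by linarith⟩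
  · exact ⟨k % (2 * m) - 2 * m, by omega, by omega, k / (2 * m) + 1, by linarith⟩

lemma cos_ang_congr (hm : 0 < m) {p q : ℤ} (h : (2 * m : ℤ) ∣ p - q) :
    Real.cos (ang m p) = Real.cos (ang m q) := by
  have := congrFun ((SA_eq hm).2 h) 0
  simpa [SA] using this

lemma ang_neg (k : ℤ) : ang m (-k) = - ang m k := by unfold ang; push_cast; ring

lemma dvd_even {a b : ℤ} (h : (2 * m : ℤ) ∣ a - b) : Even a ↔ Even b := by
  obtain ⟨n, hn⟩ := h
  have : a = b + 2 * (m * n) := by linarith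
  rw [this]; simp [Int.even_add]

lemma cos_lt (hm : 0 < m) {a b : ℤ} (ha : 0 ≤ a) (hab : a < b) (hb : b ≤ m) :
    Real.cos (ang m b) < Real.cos (ang m a) := by
  have hm' : (0:ℝ) < m := by positivity
  have ha' : (0:ℝ) ≤ a := by exact_mod_cast ha
  have hab' : (a:ℝ) < b := by exact_mod_cast hab
  have hb' : (b:ℝ) ≤ m := by exact_mod_cast hb
  apply Real.strictAntiOn_cos
  · refine ⟨by unfold ang; positivity, ?_⟩
    unfold ang
    rw [div_le_iff₀ hm']
    nlinarith [Real.pi_pos]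
  · refine ⟨by unfold ang; have : (0:ℝ) ≤ b := by linarith
               positivity, ?_⟩
    unfold ang
    rw [div_le_iff₀ hm']
    nlinarith [Real.pi_pos]
  · unfold ang
    rw [div_lt_div_iff_of_pos_right hm']
    nlinarith [Real.pi_pos]

lemma cos_odd (hm : 0 < m) {k : ℤ} (hk : Odd k) : Real.cos (ang m k) ≤ Real.cos (ang m 1) ∧
    (Real.cos (ang m k) = Real.cos (ang m 1) → (2 * m : ℤ) ∣ k - 1 ∨ (2 * m : ℤ) ∣ k + 1) := by
  obtain ⟨r, hr1, hr2, hr3⟩ := exists_rep hm k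
  have hro : Odd r := by
    rw [← Int.not_even_iff_odd] at hk ⊢
    rwa [← dvd_even hr3]
  have hr0 : r ≠ 0 := by rintro rfl; simp at hro
  have key : ∀ s : ℤ, 0 < s → s ≤ m → Real.cos (ang m s) ≤ Real.cos (ang m 1) ∧
      (Real.cos (ang m s) = Real.cos (ang m 1) → s = 1) := by
    intro s h0 h1
    rcases (by omega : s = 1 ∨ 1 < s) with rfl | h
    · simp
    · have := cos_lt hm (by norm_num) h h1
      exact ⟨this.le, fun he => by linarith⟩
  rw [cos_ang_congr hm hr3]
  rcases lt_or_gt_of_ne hr0 with h | h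
  · have := key (-r) (by omega) (by omega)
    rw [ang_neg, Real.cos_neg] at this
    refine ⟨this.1, fun he => Or.inr ?_⟩
    have := this.2 he
    have hr : r = -1 := by omega
    simpa [hr] using hr3
  · have := key r (by omega) hr2
    refine ⟨this.1, fun he => Or.inl ?_⟩
    rw [this.2 he] at hr3
    exact hr3

/-- The standard point set. -/
def Aset (m : ℕ) : Finset Pt3 := stdBot m ∪ stdAntiTop m

lemma mem_stdBot (hm : 0 < m) (x : Pt3) : x ∈ stdBot m ↔ ∃ p, Even p ∧ SA m p = x := by
  unfold stdBot
  simp only [Finset.mem_image, Finset.mem_univ, true_and]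
  constructor
  · rintro ⟨k, rfl⟩
    refine ⟨2 * k.1, by simp, ?_⟩
    unfold SA
    rw [par_even (by simp)]
    have : ang m (2 * (k.1 : ℤ)) = 2 * Real.pi * k.1 / m := by unfold ang; push_cast; ring
    rw [this]
  · rintro ⟨p, hp, rfl⟩
    have h1 := Int.emod_nonneg p (by omega : (2 * m : ℤ) ≠ 0)
    have h2 := Int.emod_lt_of_pos p (by omega : (0:ℤ) < 2 * m)
    have h3 := Int.emod_add_mul_ediv p (2 * m)
    have hd : (2 * m : ℤ) ∣ p - p % (2 * m) := ⟨p / (2 * m), by linarith⟩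
    obtain ⟨a, ha⟩ := (dvd_even hd).1 hp
    refine ⟨⟨a.toNat, by omega⟩, ?_⟩
    rw [(SA_eq hm).2 hd]
    unfold SA
    rw [par_even ⟨a, ha⟩]
    have : ang m (p % (2 * m)) = 2 * Real.pi * (a.toNat : ℕ) / m := by
      have e : ((a.toNat : ℕ) : ℝ) = ((a : ℤ) : ℝ) := by
        have : ((a.toNat : ℕ) : ℤ) = a := Int.toNat_of_nonneg (by omega)
        exact_mod_cast this
      unfold ang; rw [ha, e]; push_cast; ring
    rw [this]

lemma mem_stdTop (hm : 0 < m) (x : Pt3) : x ∈ stdAntiTop m ↔ ∃ p, Odd p ∧ SA m p = x := by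
  unfold stdAntiTop
  simp only [Finset.mem_image, Finset.mem_univ, true_and]
  constructor
  · rintro ⟨k, rfl⟩
    refine ⟨2 * k.1 + 1, by simp, ?_⟩
    unfold SA
    rw [par_odd (by simp)]
    have : ang m (2 * (k.1 : ℤ) + 1) = Real.pi * (2 * k.1 + 1) / m := by unfold ang; push_cast; ring
    rw [this]
  · rintro ⟨p, hp, rfl⟩
    have h1 := Int.emod_nonneg p (by omega : (2 * m : ℤ) ≠ 0)
    have h2 := Int.emod_lt_of_pos p (by omega : (0:ℤ) < 2 * m)
    have h3 := Int.emod_add_mul_ediv p (2 * m)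
    have hd : (2 * m : ℤ) ∣ p - p % (2 * m) := ⟨p / (2 * m), by linarith⟩
    have hodd : Odd (p % (2 * m)) := by
      rw [← Int.not_even_iff_odd] at hp ⊢
      rwa [← dvd_even hd]
    obtain ⟨a, ha⟩ := id hodd
    refine ⟨⟨a.toNat, by omega⟩, ?_⟩
    rw [(SA_eq hm).2 hd]
    unfold SA
    rw [par_odd hodd]
    have : ang m (p % (2 * m)) = Real.pi * (2 * (a.toNat : ℕ) + 1) / m := by
      have e : ((a.toNat : ℕ) : ℝ) = ((a : ℤ) : ℝ) := by
        have : ((a.toNat : ℕ) : ℤ) = a := Int.toNat_of_nonneg (by omega)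
        exact_mod_cast this
      unfold ang; rw [ha, e]; push_cast; ring
    rw [this]

lemma mem_Aset (hm : 0 < m) (x : Pt3) : x ∈ Aset m ↔ ∃ p, SA m p = x := by
  unfold Aset
  rw [Finset.mem_union, mem_stdBot hm, mem_stdTop hm]
  constructor
  · rintro (⟨p, -, rfl⟩ | ⟨p, -, rfl⟩) <;> exact ⟨p, rfl⟩
  · rintro ⟨p, rfl⟩
    rcases Int.even_or_odd p with hp | hp
    · exact Or.inl ⟨p, hp, rfl⟩
    · exact Or.inr ⟨p, hp, rfl⟩

lemma card_stdBot (hm : 0 < m) : (stdBot m).card = m := by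
  unfold stdBot
  rw [Finset.card_image_of_injective]
  · simp
  · intro k l hkl
    have e : ∀ k : Fin m, SA m (2 * k.1 : ℤ) =
        ![Real.cos (2 * Real.pi * k.1 / m), Real.sin (2 * Real.pi * k.1 / m), 0] := by
      intro k
      unfold SA
      rw [par_even (by simp)]
      have : ang m (2 * (k.1 : ℤ)) = 2 * Real.pi * k.1 / m := by unfold ang; push_cast; ring
      rw [this]
    have h2 : SA m (2 * k.1 : ℤ) = SA m (2 * l.1 : ℤ) := by rw [e, e]; exact hkl
    have := Int.eq_zero_of_abs_lt_dvd ((SA_eq hm).1 h2) (by rw [abs_lt]; omega)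
    apply Fin.ext; omega

lemma card_stdTop (hm : 0 < m) : (stdAntiTop m).card = m := by
  unfold stdAntiTop
  rw [Finset.card_image_of_injective]
  · simp
  · intro k l hkl
    have e : ∀ k : Fin m, SA m (2 * k.1 + 1 : ℤ) =
        ![Real.cos (Real.pi * (2 * k.1 + 1) / m), Real.sin (Real.pi * (2 * k.1 + 1) / m), 1] := by
      intro k
      unfold SA
      rw [par_odd (by simp)]
      have : ang m (2 * (k.1 : ℤ) + 1) = Real.pi * (2 * k.1 + 1) / m := by unfold ang; push_cast; ring
      rw [this]
    have h2 : SA m (2 * k.1 + 1 : ℤ) = SA m (2 * l.1 + 1 : ℤ) := by rw [e, e]; exact hkl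
    have := Int.eq_zero_of_abs_lt_dvd ((SA_eq hm).1 h2) (by rw [abs_lt]; omega)
    apply Fin.ext; omega

/-- A standard face functional gives an extreme set. -/
lemma std_extreme {S : Finset Pt3} (hm : 0 < m) (f : Aff3) (hf : ∀ p, 0 ≤ f (SA m p))
    (hS : ∀ x, x ∈ S ↔ ∃ p, SA m p = x ∧ f (SA m p) = 0) :
    IsExtreme ℝ (hull (Aset m)) (hull S) := by
  have : S = (Aset m).filter (fun v => f v = 0) := by
    ext x
    rw [hS, Finset.mem_filter, mem_Aset hm]
    constructor
    · rintro ⟨p, rfl, h⟩; exact ⟨⟨p, rfl⟩, h⟩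
    · rintro ⟨⟨p, rfl⟩, h⟩; exact ⟨p, rfl, h⟩
  rw [this]
  apply extreme_of_face
  intro v hv
  obtain ⟨p, rfl⟩ := (mem_Aset hm v).1 hv
  exact hf p

lemma lin3_SA (a b c d : ℝ) (p : ℤ) :
    lin3 a b c d (SA m p) = a * Real.cos (ang m p) + b * Real.sin (ang m p) + c * par p + d := by
  rw [lin3_apply]; simp [SA]

lemma std_bot (hm : 0 < m) : IsExtreme ℝ (hull (Aset m)) (hull (stdBot m)) := by
  have e : ∀ p, lin3 0 0 1 0 (SA m p) = par p := fun p => by rw [lin3_SA]; ring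
  apply std_extreme hm (lin3 0 0 1 0)
  · intro p
    rw [e]; unfold par; split_ifs <;> simp
  · intro x
    rw [mem_stdBot hm]
    constructor
    · rintro ⟨p, hp, rfl⟩; exact ⟨p, rfl, by rw [e, par_even hp]⟩
    · rintro ⟨p, rfl, h⟩
      refine ⟨p, ?_, rfl⟩
      by_contra hn
      rw [e, par_odd (by simpa using hn)] at h
      exact one_ne_zero h

lemma std_top (hm : 0 < m) : IsExtreme ℝ (hull (Aset m)) (hull (stdAntiTop m)) := by
  have e : ∀ p, lin3 0 0 (-1) 1 (SA m p) = 1 - par p := fun p => by rw [lin3_SA]; ring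
  apply std_extreme hm (lin3 0 0 (-1) 1)
  · intro p
    rw [e]; unfold par; split_ifs <;> simp
  · intro x
    rw [mem_stdTop hm]
    constructor
    · rintro ⟨p, hp, rfl⟩; exact ⟨p, rfl, by rw [e, par_odd hp]; ring⟩
    · rintro ⟨p, rfl, h⟩
      refine ⟨p, ?_, rfl⟩
      by_contra hn
      rw [e, par_even (by simpa using hn)] at h
      norm_num at h

/-- The functional `t - s ⟨e p, xy⟩ + r * (parity differs from p)`. -/
lemma par_fun (p : ℤ) (t r : ℝ) : ∃ f : Aff3, ∀ q,
    f (SA m q) = t - Real.cos (ang m (q - p)) + (if Even (q - p) then 0 else r) := by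
  rcases Int.even_or_odd p with hp | hp
  · refine ⟨lin3 (-Real.cos (ang m p)) (-Real.sin (ang m p)) r t, fun q => ?_⟩
    rw [lin3_SA, ← ang_sub, Real.cos_sub]
    rcases Int.even_or_odd q with hq | hq
    · rw [par_even hq, if_pos (hq.sub hp)]; ring
    · rw [par_odd hq, if_neg (by simpa using hq.sub_even hp)]; ring
  · refine ⟨lin3 (-Real.cos (ang m p)) (-Real.sin (ang m p)) (-r) (t + r), fun q => ?_⟩
    rw [lin3_SA, ← ang_sub, Real.cos_sub]
    rcases Int.even_or_odd q with hq | hq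
    · rw [par_even hq, if_neg (by simpa using hq.sub_odd hp)]; ring
    · rw [par_odd hq, if_pos (hq.sub_odd hp)]; ring

lemma std_single (hm : 0 < m) (p : ℤ) : IsExtreme ℝ (hull (Aset m)) (hull {SA m p}) := by
  obtain ⟨f, hf⟩ := par_fun (m := m) p 1 0
  apply std_extreme hm f
  · intro q
    rw [hf]
    have := Real.cos_le_one (ang m (q - p))
    split_ifs <;> linarith
  · intro x
    rw [Finset.mem_singleton]
    constructor
    · rintro rfl
      refine ⟨p, rfl, ?_⟩
      rw [hf]; simp [ang]
    · rintro ⟨q, rfl, h⟩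
      rw [hf] at h
      simp only [ite_self] at h
      rw [SA_eq hm, ← cos_ang_one hm]
      linarith

lemma std_tri (hm : 0 < m) (p : ℤ) :
    IsExtreme ℝ (hull (Aset m)) (hull {SA m p, SA m (p + 1), SA m (p + 2)}) := by
  obtain ⟨f, hf⟩ := par_fun (m := m) (p + 1) 1 (Real.cos (ang m 1) - 1)
  have hE : ∀ q, Even (q - (p + 1)) → f (SA m q) = 1 - Real.cos (ang m (q - (p + 1))) := by
    intro q hq
    rw [hf, if_pos hq]; ring
  have hO : ∀ q, Odd (q - (p + 1)) →
      f (SA m q) = Real.cos (ang m 1) - Real.cos (ang m (q - (p + 1))) := by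
    intro q hq
    rw [hf, if_neg (by simpa using hq)]; ring
  apply std_extreme hm f
  · intro q
    rcases Int.even_or_odd (q - (p + 1)) with h | h
    · rw [hE q h]; linarith [Real.cos_le_one (ang m (q - (p + 1)))]
    · rw [hO q h]; linarith [(cos_odd hm h).1]
  · intro x
    simp only [Finset.mem_insert, Finset.mem_singleton]
    constructor
    · rintro (rfl | rfl | rfl)
      · refine ⟨_, rfl, ?_⟩
        have e : p - (p + 1) = -1 := by ring
        rw [hO _ (by rw [e]; decide), e, ang_neg, Real.cos_neg, sub_self]
      · refine ⟨_, rfl, ?_⟩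
        rw [hE _ (by simp)]; simp [ang]
      · refine ⟨_, rfl, ?_⟩
        have e : p + 2 - (p + 1) = 1 := by ring
        rw [hO _ (by rw [e]; decide), e, sub_self]
    · rintro ⟨q, rfl, h⟩
      rcases Int.even_or_odd (q - (p + 1)) with h' | h'
      · right; left
        rw [hE q h'] at h
        rw [SA_eq hm, ← cos_ang_one hm]; linarith
      · rw [hO q h'] at h
        rcases (cos_odd hm h').2 (by linarith) with h1 | h1
        · right; right
          rw [SA_eq hm]
          convert h1 using 1; ring
        · left
          rw [SA_eq hm]
          convert h1 using 1; ring

end std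


section std
variable {m : ℕ}

/-- The center of the standard antiprism. -/
def ctr : Pt3 := ![0, 0, 1 / 2]

lemma sum_ang (hm : 0 < m) : (∑ i ∈ Finset.range (2 * m), Real.cos (ang m i)) = 0 ∧
    (∑ i ∈ Finset.range (2 * m), Real.sin (ang m i)) = 0 := by
  have hp := Complex.isPrimitiveRoot_exp (2 * m) (by omega)
  have hs := hp.geom_sum_eq_zero (by omega)
  have hm' : (m : ℂ) ≠ 0 := by exact_mod_cast hm.ne'
  have he : ∀ i : ℕ, Complex.exp (2 * Real.pi * Complex.I / ((2 * m : ℕ) : ℂ)) ^ i =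
      (Real.cos (ang m i) : ℂ) + (Real.sin (ang m i) : ℂ) * Complex.I := by
    intro i
    rw [← Complex.exp_nat_mul, Complex.ofReal_cos, Complex.ofReal_sin, ← Complex.exp_mul_I]
    congr 1
    unfold ang
    push_cast
    field_simp
  rw [Finset.sum_congr rfl (fun i _ => he i)] at hs
  have h1 := congrArg Complex.re hs
  have h2 := congrArg Complex.im hs
  simp only [Complex.re_sum, Complex.im_sum, Complex.add_re, Complex.add_im, Complex.ofReal_re,
    Complex.ofReal_im, Complex.mul_re, Complex.mul_im, Complex.I_re, Complex.I_im, mul_zero, mul_one,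
    add_zero, zero_add, Complex.zero_re, Complex.zero_im, sub_self] at h1 h2
  exact ⟨h1, h2⟩

lemma sum_par (n : ℕ) : (∑ i ∈ Finset.range (2 * n), par i) = n := by
  induction n with
  | zero => simp
  | succ n ih =>
    rw [show 2 * (n + 1) = 2 * n + 1 + 1 by ring, Finset.sum_range_succ, Finset.sum_range_succ, ih,
      par_even (by simp), par_odd (by push_cast; simp)]
    push_cast; ring

lemma sum_SA (hm : 0 < m) : (∑ i ∈ Finset.range (2 * m), SA m i) = ((2 * m : ℕ) : ℝ) • ctr := by
  obtain ⟨h1, h2⟩ := sum_ang hm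
  have h3 := sum_par m
  ext j
  rw [Finset.sum_apply]
  fin_cases j
  · simpa [SA, ctr] using h1
  · simpa [SA, ctr] using h2
  · simp only [SA, ctr]
    simp
    rw [h3]; ring

lemma SA_mem (hm : 0 < m) (p : ℤ) : SA m p ∈ Aset m := (mem_Aset hm _).2 ⟨p, rfl⟩

lemma ctr_mem (hm : 0 < m) : ctr ∈ hull (Aset m) := by
  have hm' : ((2 * m : ℕ) : ℝ) ≠ 0 := by positivity
  have : ctr = ∑ i ∈ Finset.range (2 * m), (((2 * m : ℕ) : ℝ)⁻¹) • SA m i := by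
    rw [← Finset.smul_sum, sum_SA hm, smul_smul, inv_mul_cancel₀ hm', one_smul]
  rw [this]
  apply (convex_convexHull ℝ _).sum_mem
  · intro i _; positivity
  · rw [Finset.sum_const, Finset.card_range, nsmul_eq_mul, mul_inv_cancel₀ hm']
  · intro i _
    exact mem_hull (SA_mem hm _)

lemma ctr_push (hm : 0 < m) (p : ℤ) : ∃ e : ℝ, 0 < e ∧
    AffineMap.lineMap ctr (SA m p) (-e) ∈ hull (Aset m) := by
  have h1 := Int.emod_nonneg p (by omega : (2 * m : ℤ) ≠ 0)
  have h2 := Int.emod_lt_of_pos p (by omega : (0:ℤ) < 2 * m)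
  have h3 := Int.emod_add_mul_ediv p (2 * m)
  have hd : (2 * m : ℤ) ∣ p - p % (2 * m) := ⟨p / (2 * m), by linarith⟩
  obtain ⟨j, hj⟩ := Int.eq_ofNat_of_zero_le h1
  rw [(SA_eq hm).2 hd, hj]
  have hjm : j ∈ Finset.range (2 * m) := by rw [Finset.mem_range]; omega
  have hM : (0:ℝ) < 2 * m - 1 := by
    have : (1:ℝ) ≤ m := by exact_mod_cast hm
    linarith
  refine ⟨(2 * m - 1 : ℝ)⁻¹, by positivity, ?_⟩
  have hsum := sum_SA hm
  rw [← Finset.add_sum_erase _ _ hjm] at hsum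
  have hs2 : (∑ i ∈ (Finset.range (2 * m)).erase j, SA m i) = ((2 * m : ℕ) : ℝ) • ctr - SA m j := by
    rw [← hsum]; abel
  have : (AffineMap.lineMap ctr (SA m j) (-(2 * m - 1 : ℝ)⁻¹) : Pt3)
      = ∑ i ∈ (Finset.range (2 * m)).erase j, ((2 * m - 1 : ℝ)⁻¹) • SA m i := by
    rw [← Finset.smul_sum, hs2]
    ext k
    simp only [AffineMap.lineMap_apply, vsub_eq_sub, vadd_eq_add, Pi.add_apply, Pi.smul_apply,
      Pi.sub_apply, smul_eq_mul]
    push_cast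
    field_simp
    ring
  rw [this]
  apply (convex_convexHull ℝ _).sum_mem
  · intro i _; positivity
  · rw [Finset.sum_const, Finset.card_erase_of_mem hjm, Finset.card_range, nsmul_eq_mul,
      Nat.cast_sub (by omega)]
    push_cast
    rw [mul_inv_cancel₀ hM.ne']
  · intro i _
    exact mem_hull (SA_mem hm _)

/-- If an extreme set contains the center, it is everything. -/
lemma ctr_all (hm : 0 < m) {S : Finset Pt3} (hS : S ⊆ Aset m)
    (hE : IsExtreme ℝ (hull (Aset m)) (hull S)) (hc : ctr ∈ hull S) : S = Aset m := by
  apply Finset.Subset.antisymm hS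
  have hV : AllExt (Aset m) := by
    intro v hv
    obtain ⟨p, rfl⟩ := (mem_Aset hm v).1 hv
    have := std_single hm p
    unfold hull at this
    rw [Finset.coe_singleton, convexHull_singleton, isExtreme_singleton] at this
    exact this
  intro v hv
  obtain ⟨p, rfl⟩ := (mem_Aset hm v).1 hv
  obtain ⟨e, he, h⟩ := ctr_push hm p
  exact ext_mem hV hS hv (extreme_push hE (mem_hull hv) hc he h)

lemma mid_identity (hm : 0 < m) {p q : ℤ} (hd : 3 ≤ q - p) (hd' : q - p ≤ m) (ho : Odd (q - p)) :
    ∃ r : ℝ, 0 ≤ r ∧ r < 1 ∧ (AffineMap.lineMap (SA m p) (SA m q) (1 / 2 : ℝ) : Pt3) =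
      AffineMap.lineMap ctr (AffineMap.lineMap (SA m (p + 1)) (SA m (q - 1)) (1 / 2 : ℝ)) r := by
  have hmR : (0:ℝ) < m := by positivity
  set a : ℝ := (ang m q - ang m p) / 2 with ha
  set b : ℝ := (ang m (q - 1) - ang m (p + 1)) / 2 with hb
  set s : ℝ := (ang m q + ang m p) / 2 with hs
  have hs' : (ang m (q - 1) + ang m (p + 1)) / 2 = s := by
    rw [hs]; unfold ang; push_cast; ring
  have hdR : (3:ℝ) ≤ (q:ℝ) - p := by exact_mod_cast hd
  have hdR' : (q:ℝ) - p ≤ m := by exact_mod_cast hd'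
  have ea : a = Real.pi * ((q - p) / 2) / m := by rw [ha]; unfold ang; ring
  have eb : b = Real.pi * ((q - p) / 2 - 1) / m := by rw [hb]; unfold ang; push_cast; ring
  have hpi := Real.pi_pos
  have a1 : a ≤ Real.pi / 2 := by
    rw [ea, div_le_iff₀ hmR]; nlinarith
  have a0 : 0 ≤ a := by rw [ea]; apply div_nonneg _ hmR.le; apply mul_nonneg hpi.le; linarith
  have b0 : 0 ≤ b := by rw [eb]; apply div_nonneg _ hmR.le; apply mul_nonneg hpi.le; linarith
  have hba : b < a := by
    rw [ea, eb, div_lt_div_iff_of_pos_right hmR]; nlinarith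
  have ca : 0 ≤ Real.cos a := Real.cos_nonneg_of_mem_Icc ⟨by linarith, a1⟩
  have cab : Real.cos a < Real.cos b := Real.cos_lt_cos_of_nonneg_of_le_pi_div_two b0 a1 hba
  have cb : 0 < Real.cos b := lt_of_le_of_lt ca cab
  refine ⟨Real.cos a / Real.cos b, by positivity, by rw [div_lt_one cb]; exact cab, ?_⟩
  have c1 : Real.cos (ang m p) + Real.cos (ang m q) = 2 * Real.cos s * Real.cos a := by
    rw [add_comm, Real.cos_add_cos]
  have s1 : Real.sin (ang m p) + Real.sin (ang m q) = 2 * Real.sin s * Real.cos a := by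
    rw [add_comm, hs, ha, Real.sin_add_sin]
  have c2 : Real.cos (ang m (p + 1)) + Real.cos (ang m (q - 1)) = 2 * Real.cos s * Real.cos b := by
    rw [add_comm, Real.cos_add_cos, hs']
  have s2 : Real.sin (ang m (p + 1)) + Real.sin (ang m (q - 1)) = 2 * Real.sin s * Real.cos b := by
    rw [add_comm, Real.sin_add_sin, hs']
  have p1 : par p + par q = 1 := by
    rcases Int.even_or_odd p with h | h
    · rw [par_even h, par_odd (by have := ho.add_even h; simpa using this)]; ring
    · rw [par_odd h, par_even (by have := ho.add_odd h; simpa using this)]; ring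
  have p2 : par (p + 1) + par (q - 1) = 1 := by
    rcases Int.even_or_odd p with h | h
    · rw [par_odd h.add_one, par_even (by
        have : Odd q := by have := ho.add_even h; simpa using this
        exact this.sub_odd odd_one)]; ring
    · rw [par_even h.add_one, par_odd (by
        have : Even q := by have := ho.add_odd h; simpa using this
        exact this.sub_odd odd_one)]; ring
  have hl : ∀ x y : Pt3, ∀ k, (AffineMap.lineMap x y (1 / 2 : ℝ) : Pt3) k = (x k + y k) / 2 := by
    intro x y k
    simp only [AffineMap.lineMap_apply, vsub_eq_sub, vadd_eq_add, Pi.add_apply, Pi.smul_apply,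
      Pi.sub_apply, smul_eq_mul]
    ring
  have hl2 : ∀ x y : Pt3, ∀ r : ℝ, ∀ k, (AffineMap.lineMap x y r : Pt3) k = (1 - r) * x k + r * y k := by
    intro x y r k
    simp only [AffineMap.lineMap_apply, vsub_eq_sub, vadd_eq_add, Pi.add_apply, Pi.smul_apply,
      Pi.sub_apply, smul_eq_mul]
    ring
  ext k
  rw [hl, hl2, hl]
  fin_cases k
  · simp only [SA, ctr, Fin.zero_eta, Matrix.cons_val_zero]
    rw [c1, c2]; field_simp; ring
  · simp only [SA, ctr, Fin.mk_one, Matrix.cons_val_one, Matrix.cons_val_zero]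
    rw [s1, s2]; field_simp; ring
  · simp only [SA, ctr, Fin.reduceFinMk, Matrix.cons_val]
    rw [p1, p2]; ring

lemma far_pair (hm : 0 < m) {S : Finset Pt3} (hS : S ⊆ Aset m)
    (hE : IsExtreme ℝ (hull (Aset m)) (hull S)) {p q : ℤ} (hd : 3 ≤ q - p) (hd' : q - p ≤ m)
    (ho : Odd (q - p)) (hp : SA m p ∈ S) (hq : SA m q ∈ S) : S = Aset m := by
  apply ctr_all hm hS hE
  obtain ⟨r, r0, r1, hr⟩ := mid_identity hm hd hd' ho
  have hM := hull_line (mem_hull hp) (mem_hull hq) (by norm_num : (0:ℝ) ≤ 1 / 2) (by norm_num)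
  rw [hr] at hM
  rcases r0.eq_or_lt with h | h
  · subst h; simpa using hM
  · refine hE.2 (ctr_mem hm) (hull_line (mem_hull (SA_mem hm (p + 1))) (mem_hull (SA_mem hm (q - 1)))
      (by norm_num : (0:ℝ) ≤ 1 / 2) (by norm_num)) hM ?_
    rw [openSegment_eq_image_lineMap]
    exact ⟨r, ⟨h, r1⟩, rfl⟩

lemma adj_pair (hm : 0 < m) {S : Finset Pt3} (hS : S ⊆ Aset m) (hne : S ≠ Aset m)
    (hE : IsExtreme ℝ (hull (Aset m)) (hull S)) {p q : ℤ}
    (ho : Odd (q - p)) (hp : SA m p ∈ S) (hq : SA m q ∈ S) :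
    SA m q = SA m (p + 1) ∨ SA m q = SA m (p - 1) := by
  obtain ⟨r, hr1, hr2, hr3⟩ := exists_rep hm (q - p)
  have hro : Odd r := by
    rw [← Int.not_even_iff_odd] at ho ⊢
    rwa [← dvd_even hr3]
  have e : SA m q = SA m (p + r) := by
    rw [SA_eq hm, show q - (p + r) = q - p - r by ring]; exact hr3
  rw [e] at hq ⊢
  by_cases h1 : r = 1
  · left; rw [h1]
  by_cases h2 : r = -1
  · right; rw [h2]; rfl
  exfalso
  obtain ⟨a, ha⟩ := id hro
  rcases (by omega : 3 ≤ r ∨ r ≤ -3) with h | h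
  · exact hne (far_pair hm hS hE (p := p) (q := p + r) (by omega) (by omega) (by simpa using hro) hp hq)
  · exact hne (far_pair hm hS hE (p := p + r) (q := p) (by omega) (by omega) (by simpa using hro) hq hp)

lemma band_class (hm : 3 ≤ m) {S : Finset Pt3} (hS : S ⊆ Aset m) (hne : S ≠ Aset m)
    (hE : IsExtreme ℝ (hull (Aset m)) (hull S)) {p : ℤ} (hp : SA m p ∈ S) (hp1 : SA m (p + 1) ∈ S) :
    ∃ a, S ⊆ {SA m a, SA m (a + 1), SA m (a + 2)} := by
  have hm0 : 0 < m := by omega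
  have h4 : ∀ q, SA m q ∈ S → SA m q = SA m p ∨ SA m q = SA m (p + 2) ∨ SA m q = SA m (p + 1) ∨
      SA m q = SA m (p - 1) := by
    intro q hq
    rcases Int.even_or_odd (q - p) with h | h
    · have := adj_pair hm0 hS hne hE (p := p + 1) (q := q)
        (by rw [show q - (p + 1) = q - p - 1 by ring]; exact h.sub_odd odd_one) hp1 hq
      rw [show p + 1 + 1 = p + 2 by ring, show p + 1 - 1 = p by ring] at this
      tauto
    · have := adj_pair hm0 hS hne hE (p := p) (q := q) h hp hq
      tauto
  by_cases h2 : SA m (p + 2) ∈ S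
  · refine ⟨p, ?_⟩
    intro x hx
    obtain ⟨q, rfl⟩ := (mem_Aset hm0 x).1 (hS hx)
    simp only [Finset.mem_insert, Finset.mem_singleton]
    rcases h4 q hx with h | h | h | h
    · tauto
    · tauto
    · tauto
    · exfalso
      rw [h] at hx
      have := adj_pair hm0 hS hne hE (p := p - 1) (q := p + 2)
        (by rw [show p + 2 - (p - 1) = 3 by ring]; decide) hx h2
      rw [SA_eq hm0, SA_eq hm0] at this
      rcases this with h | h
      · have := Int.eq_zero_of_abs_lt_dvd h (by rw [abs_lt]; omega)
        omega
      · have := Int.eq_zero_of_abs_lt_dvd h (by rw [abs_lt]; omega)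
        omega
  · refine ⟨p - 1, ?_⟩
    intro x hx
    obtain ⟨q, rfl⟩ := (mem_Aset hm0 x).1 (hS hx)
    simp only [Finset.mem_insert, Finset.mem_singleton]
    rw [show p - 1 + 1 = p by ring, show p - 1 + 2 = p + 1 by ring]
    rcases h4 q hx with h | h | h | h
    · tauto
    · rw [h] at hx; exact absurd hx h2
    · tauto
    · tauto

theorem std_class (hm : 3 ≤ m) {S : Finset Pt3} (hS : S ⊆ Aset m) (hne : S ≠ Aset m)
    (hE : IsExtreme ℝ (hull (Aset m)) (hull S)) :
    S ⊆ stdBot m ∨ S ⊆ stdAntiTop m ∨ ∃ a, S ⊆ {SA m a, SA m (a + 1), SA m (a + 2)} := by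
  have hm0 : 0 < m := by omega
  by_cases h1 : S ⊆ stdBot m
  · exact Or.inl h1
  by_cases h2 : S ⊆ stdAntiTop m
  · exact Or.inr (Or.inl h2)
  right; right
  obtain ⟨x, hx, hxB⟩ := Finset.not_subset.1 h1
  obtain ⟨y, hy, hyT⟩ := Finset.not_subset.1 h2
  obtain ⟨q, rfl⟩ := (mem_Aset hm0 x).1 (hS hx)
  obtain ⟨p, rfl⟩ := (mem_Aset hm0 y).1 (hS hy)
  have hq : Odd q := by
    rw [← Int.not_even_iff_odd]
    exact fun h => hxB ((mem_stdBot hm0 _).2 ⟨q, h, rfl⟩)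
  have hp : Even p := by
    rw [← Int.not_odd_iff_even]
    exact fun h => hyT ((mem_stdTop hm0 _).2 ⟨p, h, rfl⟩)
  rcases adj_pair hm0 hS hne hE (hq.sub_even hp) hy hx with h | h
  · rw [h] at hx
    exact band_class hm hS hne hE hy hx
  · rw [h] at hx
    exact band_class hm hS hne hE hx (by rwa [show p - 1 + 1 = p by ring])

end std


theorem anti_of_combEquiv {m : ℕ} (hm : 3 ≤ m) {V : Finset Pt3} {ψ : Pt3 → Pt3}
    (h : CombEquiv (stdBot m ∪ stdAntiTop m) V ψ) {T : Finset (Finset Pt3)}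
    (hT : IsTriangulation V T) :
    Anti m V ((stdBot m).image ψ) ((stdAntiTop m).image ψ) (fun p => ψ (SA m p)) := by
  have hm0 : 0 < m := by omega
  obtain ⟨hbij, hext⟩ := h
  change Set.BijOn ψ (Aset m : Set Pt3) V at hbij
  change ∀ S ⊆ (Aset m : Set Pt3), (IsExtreme ℝ (hull (Aset m)) (convexHull ℝ S) ↔
    IsExtreme ℝ (hull V) (convexHull ℝ (ψ '' S))) at hext
  have hinj := hbij.injOn
  have hmem : ∀ x, x ∈ V ↔ ∃ p, ψ (SA m p) = x := by
    intro x
    constructor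
    · intro hx
      obtain ⟨a, ha, rfl⟩ := hbij.surjOn (Finset.mem_coe.2 hx)
      obtain ⟨p, rfl⟩ := (mem_Aset hm0 a).1 (Finset.mem_coe.1 ha)
      exact ⟨p, rfl⟩
    · rintro ⟨p, rfl⟩
      exact Finset.mem_coe.1 (hbij.mapsTo (Finset.mem_coe.2 (SA_mem hm0 p)))
  have hE : ∀ S ⊆ Aset m, (IsExtreme ℝ (hull (Aset m)) (hull S) ↔
      IsExtreme ℝ (hull V) (hull (S.image ψ))) := by
    intro S hS
    have := hext (S : Set Pt3) (by exact_mod_cast hS)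
    unfold hull
    rw [Finset.coe_image]
    exact this
  have hBs : stdBot m ⊆ Aset m := Finset.subset_union_left
  have hTs : stdAntiTop m ⊆ Aset m := Finset.subset_union_right
  have heq : ∀ p q, ψ (SA m p) = ψ (SA m q) ↔ (2 * m : ℤ) ∣ p - q := by
    intro p q
    rw [← SA_eq hm0]
    exact ⟨fun he => hinj (Finset.mem_coe.2 (SA_mem hm0 p)) (Finset.mem_coe.2 (SA_mem hm0 q)) he,
      fun he => by rw [he]⟩
  have hext' : AllExt V := by
    intro v hv
    obtain ⟨p, rfl⟩ := (hmem v).1 hv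
    have := (hE {SA m p} (by simpa using SA_mem hm0 p)).1 (std_single hm0 p)
    unfold hull at this
    rw [Finset.image_singleton, Finset.coe_singleton, convexHull_singleton, isExtreme_singleton] at this
    exact this
  have hInterior : (interior (hull V)).Nonempty := by
    have h0 := mem_hull ((hmem _).2 ⟨0, rfl⟩)
    obtain ⟨σ, hσ, -⟩ := near hT h0 h0
    exact (tet_int (tri_tet hT hσ)).mono (interior_mono (hull_mono (tri_sub hT hσ)))
  have himg : ∀ S ⊆ Aset m, S.image ψ ⊆ V := by
    intro S hS x hx
    obtain ⟨a, ha, rfl⟩ := Finset.mem_image.1 hx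
    exact Finset.mem_coe.1 (hbij.mapsTo (Finset.mem_coe.2 (hS ha)))
  have hcard : ∀ S ⊆ Aset m, (S.image ψ).card = S.card := by
    intro S hS
    exact Finset.card_image_of_injOn (hinj.mono (by exact_mod_cast hS))
  have hVc : V.card = 2 * m := by
    have e : V = (Aset m).image ψ := by
      apply Finset.Subset.antisymm _ (himg _ (Finset.Subset.refl _))
      intro x hx
      obtain ⟨p, rfl⟩ := (hmem x).1 hx
      exact Finset.mem_image_of_mem _ (SA_mem hm0 p)
    rw [e, hcard _ (Finset.Subset.refl _)]
    unfold Aset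
    rw [Finset.card_union_of_disjoint, card_stdBot hm0, card_stdTop hm0]
    · ring
    · rw [Finset.disjoint_left]
      intro x hx hy
      obtain ⟨p, hp, rfl⟩ := (mem_stdBot hm0 x).1 hx
      obtain ⟨q, hq, hpq⟩ := (mem_stdTop hm0 _).1 hy
      have := dvd_even ((SA_eq hm0).1 hpq)
      rw [← Int.not_even_iff_odd] at hq
      exact hq (this.2 hp)
  have hface : ∀ S ⊆ Aset m, 3 ≤ S.card → S.card < 2 * m → IsExtreme ℝ (hull (Aset m)) (hull S) →
      ∃ f, FaceOf V (S.image ψ) f := by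
    intro S hS h3 hlt hext
    refine face_of_extreme hext' hInterior (himg S hS) ?_ (by rw [hcard S hS]; exact h3) ((hE S hS).1 hext)
    intro he
    have := hcard S hS
    rw [he, hVc] at this
    omega
  have htri : ∀ p, ({SA m p, SA m (p + 1), SA m (p + 2)} : Finset Pt3) ⊆ Aset m := by
    intro p x hx
    simp only [Finset.mem_insert, Finset.mem_singleton] at hx
    rcases hx with rfl | rfl | rfl <;> exact SA_mem hm0 _
  have htric : ∀ p, ({SA m p, SA m (p + 1), SA m (p + 2)} : Finset Pt3).card = 3 := by
    intro p
    have key : ∀ a b : ℤ, a ≠ b → |a - b| < 6 → SA m a ≠ SA m b := by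
      intro a b hab hlt he
      have := Int.eq_zero_of_abs_lt_dvd ((SA_eq hm0).1 he) (by omega)
      omega
    exact Finset.card_eq_three.2 ⟨_, _, _, key _ _ (by omega) (by simp), key _ _ (by omega) (by simp),
      key _ _ (by omega) (by rw [abs_lt]; omega), rfl⟩
  have himgtri : ∀ p, ({SA m p, SA m (p + 1), SA m (p + 2)} : Finset Pt3).image ψ =
      {ψ (SA m p), ψ (SA m (p + 1)), ψ (SA m (p + 2))} := by
    intro p
    simp [Finset.image_insert]
  refine
    { hm := hm
      mem := hmem
      memB := ?_
      memT := ?_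
      eq_iff := heq
      ext := hext'
      bot := hface _ hBs (by rw [card_stdBot hm0]; exact hm) (by rw [card_stdBot hm0]; omega) (std_bot hm0)
      top := hface _ hTs (by rw [card_stdTop hm0]; exact hm) (by rw [card_stdTop hm0]; omega) (std_top hm0)
      tri := ?_
      complete := ?_
      cardB := by rw [hcard _ hBs, card_stdBot hm0]
      cardT := by rw [hcard _ hTs, card_stdTop hm0] }
  · intro x
    rw [Finset.mem_image]
    constructor
    · rintro ⟨a, ha, rfl⟩
      obtain ⟨p, hp, rfl⟩ := (mem_stdBot hm0 a).1 ha
      exact ⟨p, hp, rfl⟩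
    · rintro ⟨p, hp, rfl⟩
      exact ⟨_, (mem_stdBot hm0 _).2 ⟨p, hp, rfl⟩, rfl⟩
  · intro x
    rw [Finset.mem_image]
    constructor
    · rintro ⟨a, ha, rfl⟩
      obtain ⟨p, hp, rfl⟩ := (mem_stdTop hm0 a).1 ha
      exact ⟨p, hp, rfl⟩
    · rintro ⟨p, hp, rfl⟩
      exact ⟨_, (mem_stdTop hm0 _).2 ⟨p, hp, rfl⟩, rfl⟩
  · intro p
    rw [← himgtri]
    exact hface _ (htri p) (by rw [htric]) (by rw [htric]; omega) (std_tri hm0 p)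
  · intro f f1 f2
    let S : Finset Pt3 := (Aset m).filter (fun x => f (ψ x) = 0)
    have hS : S ⊆ Aset m := Finset.filter_subset _ _
    have hSi : S.image ψ = V.filter (fun v => f v = 0) := by
      ext x
      simp only [S, Finset.mem_image, Finset.mem_filter]
      constructor
      · rintro ⟨a, ⟨ha, h0⟩, rfl⟩
        exact ⟨Finset.mem_coe.1 (hbij.mapsTo (Finset.mem_coe.2 ha)), h0⟩
      · rintro ⟨hx, h0⟩
        obtain ⟨p, rfl⟩ := (hmem x).1 hx
        exact ⟨_, ⟨SA_mem hm0 p, h0⟩, rfl⟩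
    have hSE : IsExtreme ℝ (hull (Aset m)) (hull S) := by
      rw [hE S hS, hSi]
      exact extreme_of_face f1
    have hSne : S ≠ Aset m := by
      intro he
      obtain ⟨v, hv, hfv⟩ := f2
      obtain ⟨p, rfl⟩ := (hmem v).1 hv
      have : SA m p ∈ S := by rw [he]; exact SA_mem hm0 p
      exact hfv (Finset.mem_filter.1 this).2
    have hz : ∀ R : Finset Pt3, S ⊆ R → ∀ v ∈ V, f v = 0 → v ∈ R.image ψ := by
      intro R hR v hv hfv
      have : v ∈ S.image ψ := by rw [hSi]; exact Finset.mem_filter.2 ⟨hv, hfv⟩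
      exact Finset.image_subset_image hR this
    rcases std_class hm hS hSne hSE with h1 | h1 | ⟨a, h1⟩
    · exact ⟨_, Or.inl rfl, hz _ h1⟩
    · exact ⟨_, Or.inr (Or.inl rfl), hz _ h1⟩
    · refine ⟨_, Or.inr (Or.inr ⟨a, rfl⟩), ?_⟩
      rw [← himgtri]
      exact hz _ h1

theorem Anti.main {m : ℕ} {V Bot Top : Finset Pt3} {W : ℤ → Pt3} {T : Finset (Finset Pt3)}
    (h : Anti m V Bot Top W) (hT : IsTriangulation V T) :
    ((T.filter (fun σ => (σ ∩ Bot).card = 3 ∨ (σ ∩ Top).card = 3)).card = 2 * m - 4) ∧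
    (m - 1 ≤ (T.filter (fun σ => (σ ∩ Bot).card = 2 ∧ (σ ∩ Top).card = 2)).card) ∧
    (3 * m - 5 ≤ T.card) ∧
    (∃ T', IsTriangulation V T' ∧ T'.card = 3 * m - 5 ∧
      ∃ v ∈ Top, ∀ σ ∈ T', v ∈ σ) := by
  have hm := h.hm
  have c1 : (T.filter (fun σ => (σ ∩ Bot).card = 3 ∨ (σ ∩ Top).card = 3)).card = 2 * m - 4 := by
    obtain ⟨fb, hfb⟩ := h.bot
    obtain ⟨ft, hft⟩ := h.top
    rw [Finset.filter_or, Finset.card_union_of_disjoint,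
      face_count hT h.ext hfb (by rw [h.cardB]; omega),
      face_count hT h.ext hft (by rw [h.cardT]; omega), h.cardB, h.cardT]
    · omega
    · rw [Finset.disjoint_left]
      intro σ h1 h2
      rw [Finset.mem_filter] at h1 h2
      have := h.card_split (tri_sub hT h1.1)
      rw [(tri_tet hT h1.1).1] at this
      omega
  have c2 := h.mixed hT
  refine ⟨c1, c2, ?_, h.coning hT⟩
  have hd : Disjoint (T.filter (fun σ => (σ ∩ Bot).card = 3 ∨ (σ ∩ Top).card = 3))
      (T.filter (fun σ => (σ ∩ Bot).card = 2 ∧ (σ ∩ Top).card = 2)) := by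
    rw [Finset.disjoint_left]
    intro σ h1 h2
    rw [Finset.mem_filter] at h1 h2
    omega
  have := Finset.card_le_card (Finset.union_subset (Finset.filter_subset
    (fun σ => (σ ∩ Bot).card = 3 ∨ (σ ∩ Top).card = 3) T)
    (Finset.filter_subset (fun σ => (σ ∩ Bot).card = 2 ∧ (σ ∩ Top).card = 2) T))
  rw [Finset.card_union_of_disjoint hd] at this
  omega

/-- every triangulation of a 3-dimensional `m`-antiprism (in any
coordinatization) has exactly `2m - 4` cap-supported tetrahedra (three vertices
in one cap) and at least `m - 1` mixed tetrahedra (two vertices in each cap),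
hence at least `3m - 5` tetrahedra in total; moreover a triangulation with
exactly `3m - 5` tetrahedra exists, obtained by coning a top vertex `v` to a
triangulation of the bottom `m`-gon and to all triangular facets not
containing `v` (so all its tetrahedra contain `v`). -/
theorem antiprism_minimal_triangulation (m : ℕ) (hm : 3 ≤ m)
    (V : Finset Pt3) (ψ : Pt3 → Pt3)
    (h : CombEquiv (stdBot m ∪ stdAntiTop m) V ψ)
    (Bot Top : Finset Pt3)
    (hBot : Bot = (stdBot m).image ψ) (hTop : Top = (stdAntiTop m).image ψ)
    (T : Finset (Finset Pt3)) (hT : IsTriangulation V T) :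
    ((T.filter (fun σ => (σ ∩ Bot).card = 3 ∨ (σ ∩ Top).card = 3)).card = 2 * m - 4) ∧
    (m - 1 ≤ (T.filter (fun σ => (σ ∩ Bot).card = 2 ∧ (σ ∩ Top).card = 2)).card) ∧
    (3 * m - 5 ≤ T.card) ∧
    (∃ T', IsTriangulation V T' ∧ T'.card = 3 * m - 5 ∧
      ∃ v ∈ Top, ∀ σ ∈ T', v ∈ σ) := by
  subst hBot hTop
  exact (anti_of_combEquiv hm h hT).main hT
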